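/- Fix λ ∈ (-1/2, ∞), λ ≠ 0, and for n ≥ 2 let L2(λ,n) = ∬_{[-1,1]²} K_n^λ(x,y)² log(1/|x-y|) w^λ(x) w^λ(y) dx dy. Then, as n → ∞, ( L2(λ,n) - n·log n - (γ + 2·log 2 - 1)·n ) / n → 0, where γ is the Euler–Mascheroni constant. -/

import Mathlib

open Real MeasureTheory Finset

/-- Gegenbauer polynomials `C_n^λ`, defined by `C_0^λ(x) = 1`, `C_1^λ(x) = 2λx` and the
recurrence `n·C_n^λ(x) = 2(n+λ-1)·x·C_{n-1}^λ(x) - (n+2λ-2)·C_{n-2}^λ(x)`. -/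
noncomputable def Geg (lam : ℝ) : ℕ → ℝ → ℝ
  | 0, _ => 1
  | 1, x => 2 * lam * x
  | (n + 2), x =>
      (2 * ((n : ℝ) + 1 + lam) * x * Geg lam (n + 1) x
        - ((n : ℝ) + 2 * lam) * Geg lam n x) / ((n : ℝ) + 2)

/-- The Gegenbauer weight `w^λ(x) = Γ(λ+1)/(√π·Γ(λ+1/2))·(1-x²)^{λ-1/2}`. -/
noncomputable def wG (lam : ℝ) (x : ℝ) : ℝ :=
  Real.Gamma (lam + 1) / (Real.sqrt Real.pi * Real.Gamma (lam + 1 / 2)) *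
    (1 - x ^ 2) ^ (lam - 1 / 2)

/-- Normalization constant `γ_n^λ = √(n!·(n+λ)/(λ·(2λ)_n))`. -/
noncomputable def gamG (lam : ℝ) (n : ℕ) : ℝ :=
  Real.sqrt ((n.factorial : ℝ) * ((n : ℝ) + lam) /
    (lam * (ascPochhammer ℝ n).eval (2 * lam)))

/-- Normalized Gegenbauer polynomials `Ĉ_n^λ = γ_n^λ·C_n^λ`. -/
noncomputable def GegHat (lam : ℝ) (n : ℕ) (x : ℝ) : ℝ := gamG lam n * Geg lam n x

/-- The Gegenbauer projection kernel `K_n^λ(x,y) = ∑_{j=0}^n Ĉ_j^λ(x)Ĉ_j^λ(y)`. -/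
noncomputable def KG (lam : ℝ) (n : ℕ) (x y : ℝ) : ℝ :=
  ∑ j ∈ Finset.range (n + 1), GegHat lam j x * GegHat lam j y

noncomputable def L1 (lam : ℝ) (n : ℕ) : ℝ :=
  ∫ x in Set.Icc (-1 : ℝ) 1, ∫ y in Set.Icc (-1 : ℝ) 1,
    KG lam n x x * KG lam n y y * Real.log (1 / |x - y|) * wG lam x * wG lam y

noncomputable def L2 (lam : ℝ) (n : ℕ) : ℝ :=
  ∫ x in Set.Icc (-1 : ℝ) 1, ∫ y in Set.Icc (-1 : ℝ) 1,
    KG lam n x y ^ 2 * Real.log (1 / |x - y|) * wG lam x * wG lam y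


lemma beta_int (a : ℝ) (ha : -1 < a) :
    IntervalIntegrable (fun t : ℝ => t ^ a * (1 - t) ^ a) volume 0 1 ∧
    ∫ t in (0:ℝ)..1, t ^ a * (1 - t) ^ a = ProbabilityTheory.beta (a + 1) (a + 1) := by
  have h0 := Complex.betaIntegral_convergent (u := ((a + 1 : ℝ) : ℂ)) (v := ((a + 1 : ℝ) : ℂ))
    (by simpa using (by linarith : (0:ℝ) < a + 1)) (by simpa using (by linarith : (0:ℝ) < a + 1))
  have key : ∀ x ∈ Set.Ioc (0:ℝ) 1, ((x:ℂ) ^ (((a + 1 : ℝ) : ℂ) - 1) * (1 - (x:ℂ)) ^ (((a + 1 : ℝ) : ℂ) - 1))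
      = ((x ^ a * (1 - x) ^ a : ℝ) : ℂ) := by
    intro x hx
    have e : (((a + 1 : ℝ) : ℂ) - 1) = ((a : ℝ) : ℂ) := by push_cast; ring
    rw [e]
    rw [Complex.ofReal_mul, Complex.ofReal_cpow hx.1.le, Complex.ofReal_cpow (by linarith [hx.2])]
    push_cast; rfl
  have hI : IntervalIntegrable (fun t : ℝ => t ^ a * (1 - t) ^ a) volume 0 1 := by
    rw [intervalIntegrable_iff_integrableOn_Ioc_of_le (by norm_num)] at h0 ⊢
    have h1 := h0.congr_fun key measurableSet_Ioc
    have h2 := Integrable.re h1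
    simpa using! h2
  refine ⟨hI, ?_⟩
  rw [ProbabilityTheory.beta_eq_betaIntegralReal _ _ (by linarith) (by linarith), Complex.betaIntegral,
    intervalIntegral.integral_of_le (by norm_num), intervalIntegral.integral_of_le (by norm_num),
    setIntegral_congr_fun measurableSet_Ioc key, integral_complex_ofReal]
  simp

lemma int_w (a : ℝ) (ha : -1 < a) :
    IntegrableOn (fun x : ℝ => (1 - x ^ 2) ^ a) (Set.Icc (-1) 1) ∧
    ∫ x in Set.Icc (-1:ℝ) 1, (1 - x ^ 2) ^ a = 2 * 4 ^ a * ProbabilityTheory.beta (a + 1) (a + 1) := by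
  obtain ⟨h1, h2⟩ := beta_int a ha
  have key : ∀ x ∈ Set.Icc (-1:ℝ) 1,
     4 ^ a * (((1/2) * x + 1/2) ^ a * (1 - ((1/2) * x + 1/2)) ^ a) = (1 - x ^ 2) ^ a := by
    intro x hx
    rw [← Real.mul_rpow (by linarith [hx.1]) (by linarith [hx.2]), ← Real.mul_rpow (by norm_num)]
    · congr 1; ring
    · apply mul_nonneg <;> linarith [hx.1, hx.2]
  constructor
  · have h3 := (IntervalIntegrable.comp_add_right (IntervalIntegrable.comp_mul_left h1 (c := 1/2)) 1).const_mul (4 ^ a)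
    norm_num at h3
    rw [intervalIntegrable_iff_integrableOn_Icc_of_le (by norm_num)] at h3
    refine h3.congr_fun ?_ measurableSet_Icc
    intro x hx
    have := key x hx
    show _ = (1 - x ^ 2) ^ a
    rw [← this]
    simp only []
    rw [show 1/2 * (x + 1) = 1/2 * x + 1/2 by ring]
  · rw [← setIntegral_congr_fun measurableSet_Icc key, integral_const_mul, integral_Icc_eq_integral_Ioc,
      ← intervalIntegral.integral_of_le (by norm_num)]
    have := intervalIntegral.integral_comp_mul_add (a := -1) (b := 1) (fun t : ℝ => t ^ a * (1 - t) ^ a) (c := 1/2) (by norm_num) (1/2)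
    rw [this]
    norm_num
    rw [h2]; ring

lemma wG_int_one (lam : ℝ) (hlam : -(1 / 2) < lam) :
    IntegrableOn (wG lam) (Set.Icc (-1) 1) ∧ ∫ x in Set.Icc (-1:ℝ) 1, wG lam x = 1 := by
  obtain ⟨h1, h2⟩ := int_w (lam - 1/2) (by linarith)
  refine ⟨h1.const_mul _, ?_⟩
  unfold wG
  rw [integral_const_mul, h2, ProbabilityTheory.beta]
  have hd := Real.Gamma_mul_Gamma_add_half (lam + 1/2)
  have g1 : 0 < Real.Gamma (lam + 1/2) := Real.Gamma_pos_of_pos (by linarith)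
  have g2 : 0 < Real.Gamma (lam + 1) := Real.Gamma_pos_of_pos (by linarith)
  have g3 : 0 < Real.Gamma (2 * lam + 1) := Real.Gamma_pos_of_pos (by linarith)
  have hp : 0 < √π := Real.sqrt_pos.2 Real.pi_pos
  rw [show lam + 1/2 + 1/2 = lam + 1 by ring, show 2 * (lam + 1/2) = 2 * lam + 1 by ring,
    show 1 - (2 * lam + 1) = -(2 * lam) by ring, Real.rpow_neg (by norm_num)] at hd
  rw [show lam - 1/2 + 1 = lam + 1/2 by ring, show lam + 1/2 + (lam + 1/2) = 2 * lam + 1 by ring]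
  have h4 : (4:ℝ) ^ (lam - 1/2) = 2 ^ (2 * lam) / 2 := by
    rw [show (4:ℝ) = 2 ^ (2:ℝ) by norm_num, ← Real.rpow_mul (by norm_num),
      show 2 * (lam - 1/2) = 2 * lam - 1 by ring, Real.rpow_sub_one (by norm_num)]
  have h5 : (0:ℝ) < 2 ^ (2 * lam) := by positivity
  rw [h4]
  generalize Real.Gamma (lam + 1/2) = A at *
  generalize Real.Gamma (lam + 1) = B at *
  generalize Real.Gamma (2 * lam + 1) = D at *
  generalize (2:ℝ) ^ (2 * lam) = E at *
  field_simp at hd ⊢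
  linarith [hd]

lemma wG_nonneg (lam : ℝ) (hlam : -(1 / 2) < lam) {x : ℝ} (hx : x ∈ Set.Icc (-1:ℝ) 1) : 0 ≤ wG lam x := by
  have g1 : 0 < Real.Gamma (lam + 1/2) := Real.Gamma_pos_of_pos (by linarith)
  have g2 : 0 < Real.Gamma (lam + 1) := Real.Gamma_pos_of_pos (by linarith)
  have : 0 ≤ 1 - x ^ 2 := by nlinarith [hx.1, hx.2]
  unfold wG; positivity

noncomputable def dG (lam : ℝ) : ℕ → ℝ → ℝ
  | 0, _ => 0
  | 1, _ => 2 * lam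
  | (n + 2), x =>
      (2 * ((n : ℝ) + 1 + lam) * (Geg lam (n + 1) x + x * dG lam (n + 1) x)
        - ((n : ℝ) + 2 * lam) * dG lam n x) / ((n : ℝ) + 2)

lemma Geg_zero (lam x : ℝ) : Geg lam 0 x = 1 := by rw [Geg]
lemma Geg_one (lam x : ℝ) : Geg lam 1 x = 2 * lam * x := by rw [Geg]

lemma Geg_rec (lam : ℝ) (n : ℕ) (x : ℝ) : ((n:ℝ) + 2) * Geg lam (n + 2) x =
    2 * ((n : ℝ) + 1 + lam) * x * Geg lam (n + 1) x - ((n : ℝ) + 2 * lam) * Geg lam n x := by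
  rw [Geg]; field_simp

lemma Geg_cont (lam : ℝ) (n : ℕ) : Continuous (Geg lam n) := by
  induction n using Nat.twoStepInduction with
  | zero => have : Geg lam 0 = fun _ => 1 := by ext x; rw [Geg]
            rw [this]; fun_prop
  | one => have : Geg lam 1 = fun x => 2 * lam * x := by ext x; rw [Geg]
           rw [this]; fun_prop
  | more n h1 h2 =>
    have : Geg lam (n+2) = fun x => (2 * ((n : ℝ) + 1 + lam) * x * Geg lam (n + 1) x
        - ((n : ℝ) + 2 * lam) * Geg lam n x) / ((n : ℝ) + 2) := by ext x; rw [Geg]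
    rw [this]; fun_prop

lemma Geg_deriv (lam : ℝ) (n : ℕ) (x : ℝ) : HasDerivAt (Geg lam n) (dG lam n x) x := by
  induction n using Nat.twoStepInduction with
  | zero => have : Geg lam 0 = fun _ => 1 := by ext x; rw [Geg]
            rw [this, dG]; exact hasDerivAt_const _ _
  | one => have : Geg lam 1 = fun x => 2 * lam * x := by ext x; rw [Geg]
           rw [this, dG]; simpa using (hasDerivAt_id x).const_mul (2 * lam)
  | more n h1 h2 =>
    have : Geg lam (n+2) = fun x => (2 * ((n : ℝ) + 1 + lam) * x * Geg lam (n + 1) x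
        - ((n : ℝ) + 2 * lam) * Geg lam n x) / ((n : ℝ) + 2) := by ext x; rw [Geg]
    rw [this, dG]
    have h3 := (((((hasDerivAt_id x).const_mul (2 * ((n : ℝ) + 1 + lam))).mul h2).sub
      (h1.const_mul ((n : ℝ) + 2 * lam))).div_const ((n:ℝ) + 2))
    convert! h3 using 1
    simp; ring

lemma dG_rec (lam : ℝ) (n : ℕ) (x : ℝ) : ((n:ℝ) + 2) * dG lam (n + 2) x =
    2 * ((n : ℝ) + 1 + lam) * (Geg lam (n + 1) x + x * dG lam (n + 1) x) - ((n : ℝ) + 2 * lam) * dG lam n x := by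
  rw [dG]; field_simp

lemma Geg_AB (lam : ℝ) (n : ℕ) (x : ℝ) :
    (((n:ℝ) + 1) * Geg lam (n + 1) x = x * dG lam (n + 1) x - dG lam n x) ∧
    (dG lam (n + 1) x = x * dG lam n x + (n + 2 * lam) * Geg lam n x) := by
  induction n with
  | zero => simp [Geg, dG]; ring
  | succ n ih =>
    obtain ⟨hA, hB⟩ := ih
    have h1 := Geg_rec lam n x
    have h2 := dG_rec lam n x
    have hB' : dG lam (n + 2) x = x * dG lam (n + 1) x + ((n:ℝ) + 1 + 2 * lam) * Geg lam (n + 1) x := by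
      have hn : ((n:ℝ) + 2) ≠ 0 := by positivity
      apply mul_left_cancel₀ hn
      rw [h2]
      linear_combination (-(n + 2 * lam)) * hA
    push_cast
    refine ⟨?_, hB'⟩
    rw [hB']
    linear_combination h1 + x * hA + hB

lemma Geg_C (lam : ℝ) (n : ℕ) (x : ℝ) :
    (1 - x ^ 2) * dG lam (n + 1) x = (n + 2 * lam) * Geg lam n x - (n + 1) * x * Geg lam (n + 1) x := by
  obtain ⟨hA, hB⟩ := Geg_AB lam n x
  linear_combination x * hA + hB

lemma int_cont (lam : ℝ) (hlam : -(1 / 2) < lam) {f : ℝ → ℝ} (hf : Continuous f) :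
    IntegrableOn (fun x => f x * wG lam x) (Set.Icc (-1) 1) :=
  (wG_int_one lam hlam).1.continuousOn_mul hf.continuousOn isCompact_Icc

lemma int_lin (lam : ℝ) (hlam : -(1 / 2) < lam) (f g h : ℝ → ℝ) (hf : Continuous f) (hg : Continuous g)
    (a b : ℝ) (H : ∀ x, h x = a * f x + b * g x) :
    ∫ x in Set.Icc (-1:ℝ) 1, h x * wG lam x = a * (∫ x in Set.Icc (-1:ℝ) 1, f x * wG lam x)
      + b * ∫ x in Set.Icc (-1:ℝ) 1, g x * wG lam x := by
  rw [← integral_const_mul, ← integral_const_mul, ← integral_add]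
  · congr 1; ext x; rw [H]; ring
  · exact (int_cont lam hlam hf).const_mul a
  · exact (int_cont lam hlam hg).const_mul b

lemma dG_cont (lam : ℝ) (n : ℕ) : Continuous (dG lam n) := by
  have hc := Geg_cont lam
  induction n using Nat.twoStepInduction with
  | zero => have : dG lam 0 = fun _ => 0 := by ext x; rw [dG]
            rw [this]; fun_prop
  | one => have : dG lam 1 = fun x => 2 * lam := by ext x; rw [dG]
           rw [this]; fun_prop
  | more n h1 h2 =>
    have : dG lam (n+2) = fun x => (2 * ((n : ℝ) + 1 + lam) * (Geg lam (n + 1) x + x * dG lam (n + 1) x)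
        - ((n : ℝ) + 2 * lam) * dG lam n x) / ((n : ℝ) + 2) := by ext x; rw [dG]
    have := hc (n+1)
    rw [‹dG lam (n+2) = _›]; fun_prop

lemma pearson (lam : ℝ) (hlam : -(1 / 2) < lam) (n : ℕ) :
    ∫ x in Set.Icc (-1:ℝ) 1, ((1 - x ^ 2) * dG lam n x - (2 * lam + 1) * x * Geg lam n x) * wG lam x = 0 := by
  have hc := Geg_cont lam n
  have hd := dG_cont lam n
  have hI := int_cont lam hlam (f := fun x => (1 - x ^ 2) * dG lam n x - (2 * lam + 1) * x * Geg lam n x) (by fun_prop)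
  rw [integral_Icc_eq_integral_Ioc, ← intervalIntegral.integral_of_le (by norm_num)]
  set c := Real.Gamma (lam + 1) / (Real.sqrt Real.pi * Real.Gamma (lam + 1 / 2)) with hcdef
  rw [intervalIntegral.integral_eq_sub_of_hasDerivAt_of_le (f := fun x => c * ((1 - x ^ 2) ^ (lam + 1/2) * Geg lam n x))
    (by norm_num)]
  · simp [Real.zero_rpow (by linarith : lam + 1/2 ≠ 0), Real.zero_rpow (by linarith : lam + 2⁻¹ ≠ 0)]
  · apply Continuous.continuousOn
    have : Continuous fun x : ℝ => (1 - x ^ 2) ^ (lam + 1/2) :=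
      Continuous.rpow_const (by fun_prop) (fun x => Or.inr (by linarith))
    fun_prop
  · intro x hx
    have hx0 : 0 < 1 - x ^ 2 := by nlinarith [hx.1, hx.2]
    have h1 : HasDerivAt (fun x : ℝ => 1 - x ^ 2) (-(2 * x)) x := by
      simpa using ((hasDerivAt_pow 2 x).const_sub 1)
    have h2 := ((h1.rpow_const (p := lam + 1/2) (Or.inl hx0.ne')).mul (Geg_deriv lam n x)).const_mul c
    convert! h2 using 1
    unfold wG
    rw [← hcdef, show lam + 1/2 = (lam - 1/2) + 1 by ring, Real.rpow_add_one hx0.ne',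
      show lam - 1/2 + 1 - 1 = lam - 1/2 by ring]
    ring
  · rw [intervalIntegrable_iff_integrableOn_Icc_of_le (by norm_num)]; exact hI

lemma Geg_mean (lam : ℝ) (hlam : -(1 / 2) < lam) (n : ℕ) :
    ∫ x in Set.Icc (-1:ℝ) 1, Geg lam (n + 1) x * wG lam x = 0 := by
  have step : ∀ m : ℕ, ((m:ℝ) + 2) * (∫ x in Set.Icc (-1:ℝ) 1, Geg lam (m + 2) x * wG lam x) =
      m * (∫ x in Set.Icc (-1:ℝ) 1, (x * Geg lam (m + 1) x) * wG lam x) ∧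
      ((m:ℝ) + 2 * lam) * (∫ x in Set.Icc (-1:ℝ) 1, Geg lam m x * wG lam x) =
      ((m:ℝ) + 2 * lam + 2) * (∫ x in Set.Icc (-1:ℝ) 1, (x * Geg lam (m + 1) x) * wG lam x) := by
    intro m
    have c1 := Geg_cont lam (m + 1)
    have hp := pearson lam hlam (m + 1)
    rw [int_lin lam hlam (fun x => Geg lam m x) (fun x => x * Geg lam (m + 1) x) _ (Geg_cont _ _) (by fun_prop)
      (m + 2 * lam) (-(m + 1) - (2 * lam + 1)) (by intro x; rw [Geg_C]; ring)] at hp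
    have hr := int_lin lam hlam (fun x => x * Geg lam (m + 1) x) (fun x => Geg lam m x) (fun x => (m + 2) * Geg lam (m + 2) x)
      (by fun_prop) (Geg_cont _ _) (2 * (m + 1 + lam)) (-(m + 2 * lam)) (by intro x; rw [Geg_rec]; ring)
    simp_rw [mul_assoc ((m:ℝ) + 2)] at hr
    rw [integral_const_mul] at hr
    constructor
    · linear_combination hr - hp
    · linear_combination hp
  induction n using Nat.twoStepInduction with
  | zero =>
    have := (int_lin lam hlam (fun x => x * Geg lam 1 x) (fun x => 1) (fun x => 0) (by have := Geg_cont lam 1; fun_prop) (by fun_prop) 0 0 (by simp))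
    have hneg : ∫ x in (-1:ℝ)..1, Geg lam 1 x * wG lam x = - ∫ x in (-1:ℝ)..1, Geg lam 1 x * wG lam x := by
      conv_lhs => rw [show (-1:ℝ) = -(1) by norm_num, ← neg_neg (1:ℝ)]
      rw [← intervalIntegral.integral_comp_neg, ← intervalIntegral.integral_neg, neg_neg]
      congr 1; ext x; simp [Geg, wG]
    rw [integral_Icc_eq_integral_Ioc, ← intervalIntegral.integral_of_le (by norm_num)]
    show ∫ x in (-1:ℝ)..1, Geg lam 1 x * wG lam x = 0
    linarith
  | one =>
    have := (step 0).1
    simp at this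
    simpa using this
  | more n h1 h2 =>
    have h3 := (step (n + 1)).1
    have h4 := (step (n + 1)).2
    rw [h1] at h4
    have : ((n + 1 : ℕ):ℝ) + 2 * lam + 2 ≠ 0 := by
      push_cast; have : (0:ℝ) ≤ n := by positivity
      linarith
    have h5 : (∫ x in Set.Icc (-1:ℝ) 1, (x * Geg lam (n + 1 + 1) x) * wG lam x) = 0 := by
      have h6 : (((n + 1 : ℕ):ℝ) + 2 * lam + 2) * (∫ x in Set.Icc (-1:ℝ) 1, (x * Geg lam (n + 1 + 1) x) * wG lam x) = 0 := by
        rw [← h4]; ring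
      exact (mul_eq_zero.1 h6).resolve_left this
    rw [h5, mul_zero] at h3
    exact (mul_eq_zero.1 h3).resolve_left (by positivity)

lemma Geg_orth (lam : ℝ) (hlam : -(1 / 2) < lam) (i : ℕ) : ∀ j, i < j →
    ∫ x in Set.Icc (-1:ℝ) 1, (Geg lam i x * Geg lam j x) * wG lam x = 0 := by
  have hc := Geg_cont lam
  have hx : ∀ i j, ∫ x in Set.Icc (-1:ℝ) 1, (x * Geg lam i x * Geg lam (j + 1) x) * wG lam x =
      ((j + 2) / (2 * (j + 1 + lam))) * (∫ x in Set.Icc (-1:ℝ) 1, (Geg lam i x * Geg lam (j + 2) x) * wG lam x) +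
      ((j + 2 * lam) / (2 * (j + 1 + lam))) * (∫ x in Set.Icc (-1:ℝ) 1, (Geg lam i x * Geg lam j x) * wG lam x) := by
    intro i j
    have h1 := hc i
    have h2 := hc (j + 1)
    have h3 := hc (j + 2)
    have h4 := hc j
    apply int_lin lam hlam _ _ _ (by fun_prop) (by fun_prop)
    intro x
    have : (j:ℝ) + 1 + lam ≠ 0 := by
      have : (0:ℝ) ≤ j := by positivity
      linarith
    have hr := Geg_rec lam j x
    field_simp
    linear_combination (- Geg lam i x) * hr
  induction i using Nat.twoStepInduction with
  | zero =>
    intro j hj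
    obtain ⟨k, rfl⟩ : ∃ k, j = k + 1 := ⟨j - 1, by omega⟩
    simpa [Geg_zero] using Geg_mean lam hlam k
  | one =>
    intro j hj
    obtain ⟨k, rfl⟩ : ∃ k, j = k + 2 := ⟨j - 2, by omega⟩
    have h := hx 0 (k + 1)
    simp only [Geg_zero, mul_one, one_mul] at h
    rw [Geg_mean lam hlam, Geg_mean lam hlam k] at h
    simp only [Geg_one, mul_assoc] at h ⊢
    rw [integral_const_mul, integral_const_mul, h]; simp
  | more i h1 h2 =>
    intro j hj
    obtain ⟨k, rfl⟩ : ∃ k, j = k + 1 := ⟨j - 1, by omega⟩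
    have h := hx (i + 1) k
    rw [h2 _ (by omega), h2 _ (by omega)] at h
    have c1 := hc (i + 1)
    have c2 := hc (k + 1)
    have c3 := hc i
    rw [int_lin lam hlam (fun x => x * Geg lam (i + 1) x * Geg lam (k + 1) x) (fun x => Geg lam i x * Geg lam (k + 1) x) _
      (by fun_prop) (by fun_prop) (2 * (i + 1 + lam) / (i + 2)) (-(i + 2 * lam) / (i + 2)), h, h1 _ (by omega)]
    · simp
    · intro x
      have hr := Geg_rec lam i x
      field_simp
      linear_combination (Geg lam (k + 1) x) * hr

lemma Geg_norm_rec (lam : ℝ) (hlam : -(1 / 2) < lam) (n : ℕ) :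
    ((n:ℝ) + 1) * (n + 1 + lam) * (∫ x in Set.Icc (-1:ℝ) 1, (Geg lam (n + 1) x * Geg lam (n + 1) x) * wG lam x) =
    (n + lam) * (n + 2 * lam) * (∫ x in Set.Icc (-1:ℝ) 1, (Geg lam n x * Geg lam n x) * wG lam x) := by
  have hc := Geg_cont lam
  have c0 := hc n
  have c1 := hc (n + 1)
  have c2 := hc (n + 2)
  have e1 := int_lin lam hlam (fun x => x * Geg lam (n + 1) x * Geg lam n x) (fun x => Geg lam n x * Geg lam n x)
    (fun x => (n + 2) * (Geg lam n x * Geg lam (n + 2) x)) (by fun_prop) (by fun_prop)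
    (2 * (n + 1 + lam)) (-(n + 2 * lam)) (by intro x; have hr := Geg_rec lam n x; linear_combination (Geg lam n x) * hr)
  have e2 : ((n:ℝ) + 1) * (∫ x in Set.Icc (-1:ℝ) 1, (Geg lam (n + 1) x * Geg lam (n + 1) x) * wG lam x) =
      2 * (n + lam) * ∫ x in Set.Icc (-1:ℝ) 1, (x * Geg lam (n + 1) x * Geg lam n x) * wG lam x := by
    cases n with
    | zero =>
      rw [← integral_const_mul, ← integral_const_mul]; congr 1; ext x; simp [Geg_zero, Geg_one]; ring
    | succ m =>
      have := int_lin lam hlam (fun x => x * Geg lam (m + 1 + 1) x * Geg lam (m + 1) x) (fun x => Geg lam m x * Geg lam (m + 2) x)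
        (fun x => (m + 2) * (Geg lam (m + 2) x * Geg lam (m + 2) x)) (by fun_prop) (by have := hc m; have := hc (m+2); fun_prop)
        (2 * (m + 1 + lam)) (-(m + 2 * lam)) (by intro x; have hr := Geg_rec lam m x; linear_combination (Geg lam (m + 2) x) * hr)
      rw [Geg_orth lam hlam m (m + 2) (by omega)] at this
      simp_rw [mul_assoc ((m:ℝ) + 2)] at this
      rw [integral_const_mul] at this
      push_cast
      linear_combination this
  simp_rw [mul_assoc ((n:ℝ) + 2)] at e1
  rw [integral_const_mul, Geg_orth lam hlam n (n + 2) (by omega)] at e1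
  linear_combination (n + 1 + lam) * e2 - (n + lam) * e1

lemma Geg_norm (lam : ℝ) (hlam : -(1 / 2) < lam) (h0 : lam ≠ 0) (n : ℕ) :
    (∫ x in Set.Icc (-1:ℝ) 1, (Geg lam n x * Geg lam n x) * wG lam x) * ((n.factorial : ℝ) * ((n : ℝ) + lam)) =
    (lam * (ascPochhammer ℝ n).eval (2 * lam)) := by
  induction n with
  | zero => simp [Geg_zero, (wG_int_one lam hlam).2]
  | succ n ih =>
    have h := Geg_norm_rec lam hlam n
    rw [ascPochhammer_succ_eval, Nat.factorial_succ]
    push_cast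
    linear_combination (n.factorial : ℝ) * h + (n + 2 * lam) * ih

lemma poch_ne (lam : ℝ) (hlam : -(1 / 2) < lam) (h0 : lam ≠ 0) (n : ℕ) :
    (ascPochhammer ℝ n).eval (2 * lam) ≠ 0 := by
  induction n with
  | zero => simp
  | succ n ih =>
    rw [ascPochhammer_succ_eval]
    refine mul_ne_zero ih ?_
    cases n with
    | zero => simpa using h0
    | succ m => have : (0:ℝ) ≤ m := by positivity
                push_cast; linarith

lemma gamG_sq (lam : ℝ) (hlam : -(1 / 2) < lam) (h0 : lam ≠ 0) (n : ℕ) :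
    gamG lam n ^ 2 = ((n.factorial : ℝ) * ((n : ℝ) + lam) / (lam * (ascPochhammer ℝ n).eval (2 * lam))) ∧
    gamG lam n ^ 2 * (∫ x in Set.Icc (-1:ℝ) 1, (Geg lam n x * Geg lam n x) * wG lam x) = 1 := by
  have h1 := Geg_norm lam hlam h0 n
  have hp := poch_ne lam hlam h0 n
  have h2 : 0 ≤ (∫ x in Set.Icc (-1:ℝ) 1, (Geg lam n x * Geg lam n x) * wG lam x) :=
    setIntegral_nonneg measurableSet_Icc (fun x hx => mul_nonneg (mul_self_nonneg _) (wG_nonneg lam hlam hx))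
  set h := (∫ x in Set.Icc (-1:ℝ) 1, (Geg lam n x * Geg lam n x) * wG lam x)
  have hne : lam * (ascPochhammer ℝ n).eval (2 * lam) ≠ 0 := mul_ne_zero h0 hp
  have h3 : h ≠ 0 := by intro hz; rw [hz, zero_mul] at h1; exact hne h1.symm
  have h4 : (n.factorial : ℝ) * ((n : ℝ) + lam) / (lam * (ascPochhammer ℝ n).eval (2 * lam)) = 1 / h := by
    rw [← h1]
    have : (n.factorial : ℝ) * ((n : ℝ) + lam) ≠ 0 := by intro h'; rw [h', mul_zero] at h1; exact hne h1.symm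
    rw [div_eq_div_iff (mul_ne_zero h3 this) h3]; ring
  have h5 : gamG lam n ^ 2 = 1 / h := by
    unfold gamG; rw [h4, Real.sq_sqrt (by positivity)]
  refine ⟨by rw [h5, h4], by rw [h5]; field_simp⟩

lemma GegHat_orth (lam : ℝ) (hlam : -(1 / 2) < lam) (h0 : lam ≠ 0) (i j : ℕ) :
    ∫ x in Set.Icc (-1:ℝ) 1, (GegHat lam i x * GegHat lam j x) * wG lam x = if i = j then 1 else 0 := by
  have e : ∀ x, (GegHat lam i x * GegHat lam j x) * wG lam x =
    (gamG lam i * gamG lam j) * ((Geg lam i x * Geg lam j x) * wG lam x) := by intro x; unfold GegHat; ring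
  simp_rw [e]
  rw [integral_const_mul]
  rcases lt_trichotomy i j with h | h | h
  · rw [Geg_orth lam hlam i j h, if_neg h.ne, mul_zero]
  · subst h; rw [if_pos rfl, ← pow_two]; exact (gamG_sq lam hlam h0 i).2
  · simp_rw [mul_comm (Geg lam i _)]
    rw [Geg_orth lam hlam j i h, if_neg h.ne', mul_zero]

lemma integral_add3 {α : Type*} [MeasurableSpace α] {μ : Measure α} {f g h : α → ℝ} (hf : Integrable f μ)
    (hg : Integrable g μ) (hh : Integrable h μ) :
    ∫ x, (f x + (g x + h x)) ∂μ = ∫ x, f x ∂μ + (∫ x, g x ∂μ + ∫ x, h x ∂μ) := by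
  have : Integrable (fun x => g x + h x) μ := hg.add hh
  rw [integral_add hf this, integral_add hg hh]

noncomputable def ker2 (P : ℕ → ℝ → ℝ) (N : ℕ) (p : ℝ × ℝ) : ℝ := ∑ i ∈ range N, P i p.1 * P i p.2

lemma ker2_mul (μ : Measure ℝ) [SigmaFinite μ] (P Q : ℕ → ℝ → ℝ) (hP : ∀ i, MemLp (P i) 2 μ)
    (hQ : ∀ i, MemLp (Q i) 2 μ) (N : ℕ) :
    Integrable (fun p => ker2 P N p * ker2 Q N p) (μ.prod μ) ∧
    ∫ p, ker2 P N p * ker2 Q N p ∂(μ.prod μ) =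
      ∑ i ∈ range N, ∑ j ∈ range N, (∫ x, P i x * Q j x ∂μ) ^ 2 := by
  have hi : ∀ i j, Integrable (fun x => P i x * Q j x) μ := fun i j => (hP i).integrable_mul (hQ j)
  have e : (fun p : ℝ × ℝ => ker2 P N p * ker2 Q N p) = fun p => ∑ i ∈ range N, ∑ j ∈ range N,
      (P i p.1 * Q j p.1) * (P i p.2 * Q j p.2) := by
    ext p
    unfold ker2
    rw [Finset.sum_mul_sum]
    refine sum_congr rfl fun i _ => sum_congr rfl fun j _ => by ring
  rw [e]
  have hI : ∀ i j, Integrable (fun p : ℝ × ℝ => (P i p.1 * Q j p.1) * (P i p.2 * Q j p.2)) (μ.prod μ) :=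
    fun i j => (hi i j).mul_prod (hi i j)
  constructor
  · exact integrable_finsetSum _ fun i _ => integrable_finsetSum _ fun j _ => hI i j
  · rw [integral_finsetSum _ fun i _ => integrable_finsetSum _ fun j _ => hI i j]
    refine sum_congr rfl fun i _ => ?_
    rw [integral_finsetSum _ fun j _ => hI i j]
    refine sum_congr rfl fun j _ => ?_
    rw [integral_prod_mul (μ := μ) (ν := μ) (fun x => P i x * Q j x) (fun x => P i x * Q j x), pow_two]

lemma bessel (μ : Measure ℝ) [SigmaFinite μ] (P : ℕ → ℝ → ℝ) (q : ℝ → ℝ) (hP : ∀ i, MemLp (P i) 2 μ)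
    (hq : MemLp q 2 μ) (ho : ∀ i j, ∫ x, P i x * P j x ∂μ = if i = j then 1 else 0)
    (h1 : ∫ x, q x * q x ∂μ = 1) (N : ℕ) (a : ℕ → ℝ) :
    1 - ∑ i ∈ range N, (∫ x, P i x * q x ∂μ) ^ 2 ≤ ∫ x, (q x - ∑ i ∈ range N, a i * P i x) ^ 2 ∂μ := by
  have hi : ∀ i, Integrable (fun x => P i x * q x) μ := fun i => (hP i).integrable_mul hq
  have hij : ∀ i j, Integrable (fun x => P i x * P j x) μ := fun i j => (hP i).integrable_mul (hP j)
  have hqq : Integrable (fun x => q x * q x) μ := hq.integrable_mul hq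
  have e : ∀ x, (q x - ∑ i ∈ range N, a i * P i x) ^ 2 = q x * q x + ((∑ i ∈ range N, (-2 * a i) * (P i x * q x)) +
      ∑ i ∈ range N, ∑ j ∈ range N, (a i * a j) * (P i x * P j x)) := by
    intro x
    have e1 : ∑ i ∈ range N, (-2 * a i) * (P i x * q x) = -2 * q x * ∑ i ∈ range N, a i * P i x := by
      rw [mul_sum]; exact sum_congr rfl fun i _ => by ring
    have e2 : ∑ i ∈ range N, ∑ j ∈ range N, (a i * a j) * (P i x * P j x) = (∑ i ∈ range N, a i * P i x) ^ 2 := by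
      rw [pow_two, Finset.sum_mul_sum]
      refine sum_congr rfl fun i _ => sum_congr rfl fun j _ => by ring
    rw [e1, e2]; ring
  simp_rw [e]
  have I1 : Integrable (fun x => ∑ i ∈ range N, (-2 * a i) * (P i x * q x)) μ :=
    integrable_finsetSum _ fun i _ => (hi i).const_mul _
  have I2 : ∀ i ∈ range N, Integrable (fun x => ∑ j ∈ range N, (a i * a j) * (P i x * P j x)) μ :=
    fun i _ => integrable_finsetSum _ fun j _ => (hij i j).const_mul _
  rw [integral_add3 hqq I1 (integrable_finsetSum _ I2), h1,
    integral_finsetSum _ fun i _ => (hi i).const_mul _, integral_finsetSum _ I2]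
  have e3 : ∀ i ∈ range N, ∫ x, ∑ j ∈ range N, (a i * a j) * (P i x * P j x) ∂μ = a i ^ 2 := by
    intro i hiN
    rw [integral_finsetSum _ fun j _ => (hij i j).const_mul _]
    simp_rw [integral_const_mul, ho]
    simp only [mul_ite, mul_one, mul_zero]
    rw [Finset.sum_ite_eq, if_pos hiN, pow_two]
  rw [sum_congr rfl e3, ← sum_add_distrib]
  simp_rw [integral_const_mul]
  have : ∑ i ∈ range N, -(∫ x, P i x * q x ∂μ) ^ 2 ≤ ∑ i ∈ range N, (-2 * a i * (∫ x, P i x * q x ∂μ) + a i ^ 2) :=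
    sum_le_sum fun i _ => by nlinarith [sq_nonneg (a i - ∫ x, P i x * q x ∂μ)]
  rw [sum_neg_distrib] at this
  linarith

/-- Difference of two orthonormal kernels. -/
lemma ker2_diff (μ : Measure ℝ) [SigmaFinite μ] (P Q : ℕ → ℝ → ℝ) (hP : ∀ i, MemLp (P i) 2 μ)
    (hQ : ∀ i, MemLp (Q i) 2 μ) (hoP : ∀ i j, ∫ x, P i x * P j x ∂μ = if i = j then 1 else 0)
    (hoQ : ∀ i j, ∫ x, Q i x * Q j x ∂μ = if i = j then 1 else 0) (N M : ℕ) (ε : ℝ)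
    (hε : ∀ j, j + M < N → ∃ a : ℕ → ℝ, ∫ x, (Q j x - ∑ i ∈ range N, a i * P i x) ^ 2 ∂μ ≤ ε) (hε0 : 0 ≤ ε)
    (τ : ℝ) (hτ : 0 < τ) :
    Integrable (fun p => ker2 P N p ^ 2 - ker2 Q N p ^ 2) (μ.prod μ) ∧
    ∫ p, |ker2 P N p ^ 2 - ker2 Q N p ^ 2| ∂(μ.prod μ) ≤ τ⁻¹ * (N * ε + M) + 2 * τ * N := by
  obtain ⟨iPQ, ePQ⟩ := ker2_mul μ P Q hP hQ N
  obtain ⟨iPP, ePP⟩ := ker2_mul μ P P hP hP N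
  obtain ⟨iQQ, eQQ⟩ := ker2_mul μ Q Q hQ hQ N
  have hs : ∀ R : ℕ → ℝ → ℝ, (∀ i j, ∫ x, R i x * R j x ∂μ = if i = j then 1 else 0) →
      ∑ i ∈ range N, ∑ j ∈ range N, (∫ x, R i x * R j x ∂μ) ^ 2 = N := by
    intro R h
    simp_rw [h]
    rw [sum_congr rfl (g := fun _ => (1:ℝ))]
    · simp
    · intro i hi
      simp only [ite_pow, one_pow, ne_eq, OfNat.ofNat_ne_zero, not_false_eq_true, zero_pow]
      rw [Finset.sum_ite_eq, if_pos hi]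
  rw [hs P hoP] at ePP
  rw [hs Q hoQ] at eQQ
  set S := ∑ i ∈ range N, ∑ j ∈ range N, (∫ x, P i x * Q j x ∂μ) ^ 2 with hS
  have hS0 : 0 ≤ S := sum_nonneg fun i _ => sum_nonneg fun j _ => sq_nonneg _
  have hS1 : (N:ℝ) - S ≤ N * ε + M := by
    rw [hS, sum_comm]
    have : (N:ℝ) = ∑ j ∈ range N, (1:ℝ) := by simp
    have h2 : (N:ℝ) - ∑ j ∈ range N, ∑ i ∈ range N, (∫ x, P i x * Q j x ∂μ) ^ 2 ≤
        ∑ j ∈ range N, (ε + if j + M < N then 0 else 1) := by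
      conv_lhs => rw [this]
      rw [← sum_sub_distrib]
      refine sum_le_sum fun j _ => ?_
      split_ifs with hj
      · obtain ⟨a, ha⟩ := hε j hj
        have := bessel μ P (Q j) hP (hQ j) hoP (by simp [hoQ]) N a
        linarith
      · have : 0 ≤ ∑ i ∈ range N, (∫ x, P i x * Q j x ∂μ) ^ 2 := sum_nonneg fun i _ => sq_nonneg _
        linarith
    refine h2.trans ?_
    rw [sum_add_distrib, sum_const, card_range, nsmul_eq_mul]
    gcongr
    have : ∑ j ∈ range N, (if j + M < N then (0:ℝ) else 1) = ∑ j ∈ range N with ¬ (j + M < N), 1 := by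
      rw [sum_filter]; exact sum_congr rfl fun j _ => by by_cases hj : j + M < N <;> simp [hj]
    rw [this, sum_const, nsmul_eq_mul, mul_one]
    norm_cast
    calc _ ≤ (Finset.Ico (N - M) N).card := card_le_card (by intro j hj; simp at hj ⊢; omega)
      _ ≤ M := by rw [Nat.card_Ico]; omega
  have i1 : Integrable (fun p => ker2 P N p ^ 2 - ker2 Q N p ^ 2) (μ.prod μ) := by
    simp_rw [pow_two]; exact iPP.sub iQQ
  refine ⟨i1, ?_⟩
  have hle : ∫ p, |ker2 P N p ^ 2 - ker2 Q N p ^ 2| ∂(μ.prod μ) ≤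
      ∫ p, ((τ⁻¹ / 2 + τ / 2) * (ker2 P N p * ker2 P N p) + ((τ⁻¹ / 2 + τ / 2) * (ker2 Q N p * ker2 Q N p)
       + (τ - τ⁻¹) * (ker2 P N p * ker2 Q N p))) ∂(μ.prod μ) := by
    refine integral_mono i1.abs ((iPP.const_mul _).add ((iQQ.const_mul _).add (iPQ.const_mul _))) fun p => ?_
    simp only [Pi.add_apply]
    set f := ker2 P N p
    set g := ker2 Q N p
    have : f ^ 2 - g ^ 2 = (f - g) * (f + g) := by ring
    rw [this, abs_mul]
    have h1 : |f - g| * |f + g| ≤ τ⁻¹ / 2 * (f - g) ^ 2 + τ / 2 * (f + g) ^ 2 := by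
      rw [← sq_abs (f - g), ← sq_abs (f + g)]
      have h3 := mul_nonneg (inv_nonneg.2 hτ.le) (sq_nonneg (|f - g| - τ * |f + g|))
      have h4 : τ⁻¹ * τ = 1 := inv_mul_cancel₀ hτ.ne'
      have h5 : τ⁻¹ * (|f - g| - τ * |f + g|) ^ 2 = τ⁻¹ * |f-g|^2 - 2 * (|f - g| * |f + g|) + τ * |f+g|^2 := by
        linear_combination (-2 * |f - g| * |f+g| + τ * |f+g|^2) * h4
      linarith
    refine h1.trans (le_of_eq ?_)
    ring
  refine hle.trans ?_
  rw [integral_add3 (iPP.const_mul _) (iQQ.const_mul _) (iPQ.const_mul _), integral_const_mul, integral_const_mul, integral_const_mul,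
    ePP, eQQ, ePQ]
  have hτ' : 0 < τ⁻¹ := inv_pos.2 hτ
  have hSN : S ≤ N := by
    have : 0 ≤ ∫ p, (ker2 P N p - ker2 Q N p) ^ 2 ∂(μ.prod μ) := integral_nonneg fun p => sq_nonneg _
    have e : ∀ p, (ker2 P N p - ker2 Q N p) ^ 2 = ker2 P N p * ker2 P N p + (ker2 Q N p * ker2 Q N p + (-2) * (ker2 P N p * ker2 Q N p)) := by
      intro p; ring
    simp_rw [e] at this
    rw [integral_add3 iPP iQQ (iPQ.const_mul _), integral_const_mul, ePP, eQQ, ePQ] at this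
    linarith
  have h6 : τ⁻¹ * ((N:ℝ) - S) ≤ τ⁻¹ * (N * ε + M) := by gcongr
  have h7 : τ * S ≤ τ * N := by gcongr
  linarith

lemma trunc_bound (s : ℝ) (hs : 0 < s) : ∃ c : ℕ → ℝ, ∀ M : ℕ, ∀ x : ℝ, |x| < 1 →
    0 ≤ 1 - (1 - x ^ 2) ^ s * ∑ k ∈ range M, c k * (x ^ 2) ^ k ∧
    1 - (1 - x ^ 2) ^ s * ∑ k ∈ range M, c k * (x ^ 2) ^ k ≤ 2 ^ s * |x| ^ M := by
  set c : ℕ → ℝ := fun n => Ring.choose (s + n - 1) n with hc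
  have hc0 : ∀ n, 0 ≤ c n := by
    intro n
    have h1 : c n = Ring.multichoose s n := by
      rw [hc]; simp only [Ring.choose]; congr 1; ring
    have h2 := Ring.factorial_nsmul_multichoose_eq_ascPochhammer s n
    rw [Polynomial.ascPochhammer_smeval_eq_eval, nsmul_eq_mul] at h2
    have h3 : 0 < (ascPochhammer ℝ n).eval s := ascPochhammer_pos n s hs
    have h4 : (0:ℝ) < n.factorial := by positivity
    rw [h1]
    rw [← h2] at h3
    exact (pos_of_mul_pos_right h3 h4.le).le
  have hsum : ∀ z : ℝ, |z| < 1 → HasSum (fun n => c n * z ^ n) (1 / (1 - z) ^ s) := by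
    intro z hz
    have h := (Real.one_div_one_sub_rpow_hasFPowerSeriesOnBall_zero s).hasSum (y := z) (by
      simpa [enorm_eq_nnnorm, ← NNReal.coe_lt_coe] using hz)
    simp only [FormalMultilinearSeries.ofScalars_apply_eq, zero_add, smul_eq_mul] at h
    exact h
  refine ⟨c, fun M x hx => ?_⟩
  have hz : |x ^ 2| < 1 := by rw [abs_pow]; nlinarith [abs_nonneg x]
  have hz' : x ^ 2 < 1 := by rwa [abs_of_nonneg (sq_nonneg x)] at hz
  have hS := hsum _ hz
  have hR := hsum |x| (by rwa [abs_abs])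
  have hp : 0 < (1 - x ^ 2) ^ s := by apply Real.rpow_pos_of_pos; linarith
  have hp2 : 0 < (1 - |x|) ^ s := by apply Real.rpow_pos_of_pos; linarith
  have split := hS.summable.sum_add_tsum_nat_add M
  rw [hS.tsum_eq] at split
  have t0 : 0 ≤ ∑' i, c (i + M) * (x ^ 2) ^ (i + M) := tsum_nonneg fun i => mul_nonneg (hc0 _) (by positivity)
  have e : 1 - (1 - x ^ 2) ^ s * ∑ k ∈ range M, c k * (x ^ 2) ^ k =
      (1 - x ^ 2) ^ s * ∑' i, c (i + M) * (x ^ 2) ^ (i + M) := by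
    have : (1 - x ^ 2) ^ s * (1 / (1 - x ^ 2) ^ s) = 1 := by field_simp
    rw [← split] at this
    linarith
  rw [e]
  refine ⟨mul_nonneg hp.le t0, ?_⟩
  have t1 : ∑' i, c (i + M) * (x ^ 2) ^ (i + M) ≤ |x| ^ M * (1 / (1 - |x|) ^ s) := by
    rw [← hR.tsum_eq, ← hR.summable.sum_add_tsum_nat_add M, mul_add, ← tsum_mul_left]
    have a1 : 0 ≤ |x| ^ M * ∑ i ∈ range M, c i * |x| ^ i :=
      mul_nonneg (by positivity) (sum_nonneg fun i _ => mul_nonneg (hc0 i) (by positivity))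
    have a2 : ∑' i, c (i + M) * (x ^ 2) ^ (i + M) ≤ ∑' i, |x| ^ M * (c (i + M) * |x| ^ (i + M)) := by
      refine Summable.tsum_le_tsum (fun i => ?_) ((summable_nat_add_iff M).2 hS.summable)
        (((summable_nat_add_iff M).2 hR.summable).mul_left _)
      rw [← sq_abs, ← pow_mul, show |x| ^ M * (c (i + M) * |x| ^ (i + M)) = c (i + M) * |x| ^ (M + (i + M)) by
        rw [pow_add]; ring]
      refine mul_le_mul_of_nonneg_left ?_ (hc0 _)
      exact pow_le_pow_of_le_one (abs_nonneg x) hx.le (by omega)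
    linarith
  have e2 : (1 - x ^ 2) ^ s = (1 - |x|) ^ s * (1 + |x|) ^ s := by
    rw [← Real.mul_rpow (by linarith) (by positivity)]; congr 1; rw [← sq_abs]; ring
  have h3 : (1 + |x|) ^ s ≤ 2 ^ s := Real.rpow_le_rpow (by positivity) (by linarith) hs.le
  calc _ ≤ (1 - x ^ 2) ^ s * (|x| ^ M * (1 / (1 - |x|) ^ s)) := by gcongr
    _ = (1 + |x|) ^ s * |x| ^ M := by rw [e2]; field_simp
    _ ≤ _ := by gcongr

lemma cos_pow_bound (M : ℕ) : ∫ θ in (0:ℝ)..π, cos θ ^ (2 * M) ≤ π / √(M + 1) := by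
  induction M with
  | zero => simp
  | succ M ih =>
    rw [show 2 * (M + 1) = 2 * M + 2 by ring, integral_cos_pow]
    simp only [Real.sin_pi, Real.sin_zero, mul_zero, sub_zero, zero_div, zero_add]
    have h1 : ((2 * M : ℕ) : ℝ) + 1 = 2 * M + 1 := by push_cast; ring
    rw [h1]
    have h2 : ((2 * M : ℕ) : ℝ) + 2 = 2 * M + 2 := by push_cast; ring
    rw [h2]
    calc (2 * (M:ℝ) + 1) / (2 * M + 2) * ∫ θ in (0:ℝ)..π, cos θ ^ (2 * M)
        ≤ (2 * (M:ℝ) + 1) / (2 * M + 2) * (π / √(M + 1)) := by gcongr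
      _ ≤ _ := by
        have ha : 0 < √((M:ℝ) + 1) := by positivity
        have hb : 0 < √((M:ℝ) + 1 + 1) := by positivity
        push_cast
        rw [div_mul_div_comm, div_le_div_iff₀ (by positivity) (by positivity)]
        have key : (2 * (M:ℝ) + 1) * √((M:ℝ) + 1 + 1) ≤ (2 * M + 2) * √((M:ℝ) + 1) := by
          rw [← pow_le_pow_iff_left₀ (by positivity) (by positivity) (two_ne_zero), mul_pow, mul_pow,
            Real.sq_sqrt (by positivity), Real.sq_sqrt (by positivity)]
          have : (0:ℝ) ≤ M := by positivity
          nlinarith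
        nlinarith [Real.pi_pos]

noncomputable def SG (lam : ℝ) (N : ℕ) : Submodule ℝ (ℝ → ℝ) := Submodule.span ℝ (Set.range fun i : Fin N => Geg lam i)

lemma Geg_mem (lam : ℝ) {i N : ℕ} (h : i < N) : Geg lam i ∈ SG lam N :=
  Submodule.subset_span ⟨⟨i, h⟩, rfl⟩

lemma SG_mono (lam : ℝ) {N N' : ℕ} (h : N ≤ N') : SG lam N ≤ SG lam N' := by
  apply Submodule.span_le.2
  rintro _ ⟨i, rfl⟩
  exact Geg_mem lam (lt_of_lt_of_le i.2 h)

lemma SG_mulx (lam : ℝ) (hlam : -(1 / 2) < lam) (h0 : lam ≠ 0) (N : ℕ) (f : ℝ → ℝ) (hf : f ∈ SG lam N) :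
    (fun x => x * f x) ∈ SG lam (N + 1) := by
  induction hf using Submodule.span_induction with
  | mem f hf =>
    obtain ⟨⟨i, hi⟩, rfl⟩ := hf
    simp only
    cases i with
    | zero =>
      have : (fun x => x * Geg lam 0 x) = (1 / (2 * lam)) • Geg lam 1 := by
        ext x; simp [Geg_zero, Geg_one]; field_simp
      rw [this]; exact Submodule.smul_mem _ _ (Geg_mem lam (by omega))
    | succ k =>
      have hk : (k:ℝ) + 1 + lam ≠ 0 := by
        have : (0:ℝ) ≤ k := by positivity
        linarith
      have : (fun x => x * Geg lam (k + 1) x) = (((k:ℝ) + 2) / (2 * (k + 1 + lam))) • Geg lam (k + 2) +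
          ((k + 2 * lam) / (2 * (k + 1 + lam))) • Geg lam k := by
        ext x
        have hr := Geg_rec lam k x
        simp only [Pi.add_apply, Pi.smul_apply, smul_eq_mul]
        field_simp
        linear_combination -hr
      rw [this]
      exact Submodule.add_mem _ (Submodule.smul_mem _ _ (Geg_mem lam (by omega))) (Submodule.smul_mem _ _ (Geg_mem lam (by omega)))
  | zero =>
    have := (SG lam (N+1)).zero_mem
    convert! this using 1
    ext x; simp
  | add f g _ _ h1 h2 =>
    have := Submodule.add_mem _ h1 h2
    convert! this using 1
    ext x; simp; ring
  | smul a f _ h1 =>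
    have := Submodule.smul_mem _ a h1
    convert! this using 1
    ext x; simp; ring

lemma pow_mem_SG (lam : ℝ) (hlam : -(1 / 2) < lam) (h0 : lam ≠ 0) (k : ℕ) : (fun x : ℝ => x ^ k) ∈ SG lam (k + 1) := by
  induction k with
  | zero =>
    have : (fun x : ℝ => x ^ 0) = Geg lam 0 := by ext x; simp [Geg_zero]
    rw [this]; exact Geg_mem lam (by omega)
  | succ k ih =>
    have := SG_mulx lam hlam h0 _ _ ih
    simpa [pow_succ'] using this

lemma poly_span (lam : ℝ) (hlam : -(1 / 2) < lam) (h0 : lam ≠ 0) (N : ℕ) (p : Polynomial ℝ) (hp : p.natDegree < N) :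
    ∃ a : ℕ → ℝ, ∀ x, p.eval x = ∑ i ∈ range N, a i * GegHat lam i x := by
  have h1 : (fun x => p.eval x) ∈ SG lam N := by
    have : (fun x => p.eval x) = ∑ i ∈ range (p.natDegree + 1), p.coeff i • (fun x : ℝ => x ^ i) := by
      ext x; rw [Polynomial.eval_eq_sum_range]; simp
    rw [this]
    refine Submodule.sum_mem _ fun i hi => Submodule.smul_mem _ _ ?_
    have := mem_range.1 hi
    exact SG_mono lam (by omega) (pow_mem_SG lam hlam h0 i)
  obtain ⟨c, hc⟩ := (Submodule.mem_span_range_iff_exists_fun ℝ).1 h1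
  have hg : ∀ i, gamG lam i ≠ 0 := by
    intro i h
    have := (gamG_sq lam hlam h0 i).2
    rw [h] at this; simp at this
  refine ⟨fun i => if h : i < N then c ⟨i, h⟩ / gamG lam i else 0, fun x => ?_⟩
  have := congrFun hc x
  rw [← this, Finset.sum_range, Finset.sum_apply]
  refine sum_congr rfl fun i _ => ?_
  have := hg i
  simp only [Pi.smul_apply, smul_eq_mul, Fin.is_lt, dif_pos, GegHat, Fin.eta]
  field_simp

noncomputable def cwG (lam : ℝ) : ℝ := Real.Gamma (lam + 1) / (Real.sqrt Real.pi * Real.Gamma (lam + 1 / 2))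

lemma cwG_pos (lam : ℝ) (hlam : -(1 / 2) < lam) : 0 < cwG lam := by
  unfold cwG
  have := Real.Gamma_pos_of_pos (by linarith : 0 < lam + 1)
  have := Real.Gamma_pos_of_pos (by linarith : 0 < lam + 1 / 2)
  positivity

lemma cwG_zero : cwG 0 = π⁻¹ := by
  unfold cwG
  rw [zero_add, zero_add, Real.Gamma_one, Real.Gamma_one_half_eq, Real.mul_self_sqrt Real.pi_pos.le, one_div]

lemma wG_eq (lam x : ℝ) : wG lam x = cwG lam * (1 - x ^ 2) ^ (lam - 1 / 2) := rfl

lemma wG_zero {x : ℝ} (hx : x ∈ Set.Icc (-1:ℝ) 1) : wG 0 x = π⁻¹ * √((1 - x ^ 2)⁻¹) := by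
  rw [wG_eq, cwG_zero, Real.sqrt_inv, Real.sqrt_eq_rpow, zero_sub, Real.rpow_neg (by nlinarith [hx.1, hx.2])]

lemma int_wG_zero (f : ℝ → ℝ) : ∫ x in Set.Icc (-1:ℝ) 1, f x * wG 0 x = π⁻¹ * ∫ θ in (0:ℝ)..π, f (cos θ) := by
  rw [← Polynomial.Chebyshev.integral_measureT_eq_integral_cos (f := f), Polynomial.Chebyshev.integral_measureT,
    intervalIntegral.integral_of_le (by norm_num), ← integral_Icc_eq_integral_Ioc, ← integral_const_mul]
  refine setIntegral_congr_fun measurableSet_Icc fun x hx => ?_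
  rw [wG_zero hx]; ring

lemma wG_meas (lam : ℝ) : Measurable (wG lam) := by
  unfold wG; fun_prop

noncomputable def tT (j : ℕ) (x : ℝ) : ℝ := if j = 0 then 1 else √2 * (Polynomial.Chebyshev.T ℝ j).eval x

noncomputable def wP (lam : ℝ) (i : ℕ) (x : ℝ) : ℝ := GegHat lam i x * √(wG lam x)
noncomputable def wQ (j : ℕ) (x : ℝ) : ℝ := tT j x * √(wG 0 x)

lemma GegHat_cont (lam : ℝ) (i : ℕ) : Continuous (GegHat lam i) := by
  unfold GegHat; exact continuous_const.mul (Geg_cont lam i)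

lemma tT_cont (j : ℕ) : Continuous (tT j) := by
  unfold tT
  split_ifs
  · exact continuous_const
  · exact continuous_const.mul (Polynomial.continuous _)

lemma memLp_w (lam : ℝ) (hlam : -(1 / 2) < lam) (f : ℝ → ℝ) (hf : Continuous f) :
    MemLp (fun x => f x * √(wG lam x)) 2 (volume.restrict (Set.Icc (-1:ℝ) 1)) := by
  have hm : Measurable fun x => f x * √(wG lam x) := hf.measurable.mul (wG_meas lam).sqrt
  rw [memLp_two_iff_integrable_sq hm.aestronglyMeasurable]
  refine (int_cont lam hlam (f := fun x => f x ^ 2) (by fun_prop)).congr_fun (fun x hx => ?_) measurableSet_Icc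
  simp only
  rw [mul_pow, Real.sq_sqrt (wG_nonneg lam hlam hx)]

lemma int_w_mul (lam : ℝ) (hlam : -(1 / 2) < lam) (f g : ℝ → ℝ) :
    ∫ x in Set.Icc (-1:ℝ) 1, (f x * √(wG lam x)) * (g x * √(wG lam x)) = ∫ x in Set.Icc (-1:ℝ) 1, (f x * g x) * wG lam x := by
  refine setIntegral_congr_fun measurableSet_Icc fun x hx => ?_
  have := Real.mul_self_sqrt (wG_nonneg lam hlam hx)
  linear_combination (f x * g x) * this

lemma wP_mem (lam : ℝ) (hlam : -(1 / 2) < lam) (i : ℕ) : MemLp (wP lam i) 2 (volume.restrict (Set.Icc (-1:ℝ) 1)) :=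
  memLp_w lam hlam _ (GegHat_cont lam i)

lemma wQ_mem (i : ℕ) : MemLp (wQ i) 2 (volume.restrict (Set.Icc (-1:ℝ) 1)) :=
  memLp_w 0 (by norm_num) _ (tT_cont i)

lemma wP_orth (lam : ℝ) (hlam : -(1 / 2) < lam) (h0 : lam ≠ 0) (i j : ℕ) :
    ∫ x, wP lam i x * wP lam j x ∂(volume.restrict (Set.Icc (-1:ℝ) 1)) = if i = j then 1 else 0 :=
  (int_w_mul lam hlam _ _).trans (GegHat_orth lam hlam h0 i j)

lemma wQ_orth (i j : ℕ) :
    ∫ x, wQ i x * wQ j x ∂(volume.restrict (Set.Icc (-1:ℝ) 1)) = if i = j then 1 else 0 := by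
  refine (int_w_mul 0 (by norm_num) _ _).trans ?_
  rw [int_wG_zero (fun x => tT i x * tT j x), ← Polynomial.Chebyshev.integral_measureT_eq_integral_cos (f := fun x => tT i x * tT j x)]
  have hpi := Real.pi_pos.ne'
  have key : ∀ a b : ℝ, (∀ x, tT i x = a * (Polynomial.Chebyshev.T ℝ i).eval x) → (∀ x, tT j x = b * (Polynomial.Chebyshev.T ℝ j).eval x) →
    ∫ x, tT i x * tT j x ∂Polynomial.Chebyshev.measureT = a * b * ∫ x, (Polynomial.Chebyshev.T ℝ i).eval x * (Polynomial.Chebyshev.T ℝ j).eval x ∂Polynomial.Chebyshev.measureT := by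
    intro a b ha hb
    rw [← integral_const_mul]; congr 1; ext x; rw [ha, hb]; ring
  have hb : ∀ i : ℕ, ∀ x, tT i x = (if i = 0 then 1 else √2) * (Polynomial.Chebyshev.T ℝ i).eval x := by
    intro i x; unfold tT; split_ifs with h <;> simp [h]
  rw [key _ _ (hb i) (hb j)]
  by_cases hij : i = j
  · subst hij
    rw [if_pos rfl]
    by_cases hi : i = 0
    · subst hi
      simp only [if_true]
      have := Polynomial.Chebyshev.integral_eval_T_real_mul_self_measureT_zero
      simp only [Nat.cast_zero]
      rw [this]; field_simp
    · rw [if_neg hi, Polynomial.Chebyshev.integral_T_real_mul_self_measureT_of_ne_zero hi, Real.mul_self_sqrt (by norm_num)]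
      field_simp
  · rw [if_neg hij, Polynomial.Chebyshev.integral_eval_T_real_mul_eval_T_real_measureT_of_ne hij]; simp

lemma tT_sq_le (j : ℕ) {x : ℝ} (hx : x ∈ Set.Icc (-1:ℝ) 1) : tT j x ^ 2 ≤ 2 := by
  unfold tT
  split_ifs
  · norm_num
  · rw [mul_pow, Real.sq_sqrt (by norm_num), ← Real.cos_arccos hx.1 hx.2, Polynomial.Chebyshev.T_real_cos]
    nlinarith [Real.cos_sq_le_one (((j:ℕ):ℤ) * arccos x)]

lemma approx (lam : ℝ) (hlam : -(1 / 2) < lam) (h0 : lam ≠ 0) : ∃ C : ℝ, 0 ≤ C ∧ ∀ M j N : ℕ, j + (2 * M + 2) < N →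
    ∃ a : ℕ → ℝ, ∫ x, (wQ j x - ∑ i ∈ range N, a i * wP lam i x) ^ 2 ∂(volume.restrict (Set.Icc (-1:ℝ) 1)) ≤ C / √(M + 1) := by
  set s := 1 + lam / 2 with hs
  have hs0 : 0 < s := by linarith
  obtain ⟨c, hc⟩ := trunc_bound s hs0
  refine ⟨2 * (2 ^ s) ^ 2, by positivity, fun M j N hN => ?_⟩
  set κ := √(cwG lam / cwG 0) with hκ
  have hκ0 : 0 < κ := Real.sqrt_pos.2 (div_pos (cwG_pos lam hlam) (cwG_pos 0 (by norm_num)))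
  set p : Polynomial ℝ := (if j = 0 then 1 else Polynomial.C √2 * Polynomial.Chebyshev.T ℝ j) *
    (Polynomial.C κ⁻¹ * ((1 - Polynomial.X ^ 2) * ∑ k ∈ range M, Polynomial.C (c k) * (Polynomial.X ^ 2) ^ k)) with hp
  have hpe : ∀ x, p.eval x = tT j x * (κ⁻¹ * ((1 - x ^ 2) * ∑ k ∈ range M, c k * (x ^ 2) ^ k)) := by
    intro x
    rw [hp]
    unfold tT
    split_ifs <;> simp [Polynomial.eval_finsetSum]
  have hdeg : p.natDegree < N := by
    have d1 : (if j = 0 then (1 : Polynomial ℝ) else Polynomial.C √2 * Polynomial.Chebyshev.T ℝ j).natDegree ≤ j := by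
      split_ifs with h
      · simp
      · refine (Polynomial.natDegree_C_mul_le _ _).trans ?_
        simp
    have d2 : (∑ k ∈ range M, Polynomial.C (c k) * ((Polynomial.X : Polynomial ℝ) ^ 2) ^ k).natDegree ≤ 2 * M := by
      refine Polynomial.natDegree_sum_le_of_forall_le _ _ fun k hk => ?_
      refine (Polynomial.natDegree_C_mul_le _ _).trans ?_
      rw [← pow_mul, Polynomial.natDegree_X_pow]
      have := mem_range.1 hk; omega
    have d3 : ((1 : Polynomial ℝ) - Polynomial.X ^ 2).natDegree ≤ 2 := by
      compute_degree
    have d4 := (Polynomial.natDegree_mul_le (p := (1 : Polynomial ℝ) - Polynomial.X ^ 2) (q := ∑ k ∈ range M, Polynomial.C (c k) * ((Polynomial.X : Polynomial ℝ) ^ 2) ^ k))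
    have d5 := Polynomial.natDegree_C_mul_le κ⁻¹ (((1 : Polynomial ℝ) - Polynomial.X ^ 2) * (∑ k ∈ range M, Polynomial.C (c k) * ((Polynomial.X : Polynomial ℝ) ^ 2) ^ k))
    have d6 : p.natDegree ≤ _ := Polynomial.natDegree_mul_le
    omega
  obtain ⟨a, ha⟩ := poly_span lam hlam h0 N p hdeg
  refine ⟨a, ?_⟩
  have hsum : ∀ x, ∑ i ∈ range N, a i * wP lam i x = p.eval x * √(wG lam x) := by
    intro x; rw [ha, sum_mul]; exact sum_congr rfl fun i _ => by unfold wP; ring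
  simp_rw [hsum, hpe]
  have hbd : ∀ x ∈ Set.Ioo (-1:ℝ) 1, (wQ j x - tT j x * (κ⁻¹ * ((1 - x ^ 2) * ∑ k ∈ range M, c k * (x ^ 2) ^ k)) * √(wG lam x)) ^ 2 ≤
      2 * (2 ^ s) ^ 2 * (x ^ (2 * M) * wG 0 x) := by
    intro x hx
    have hx' : x ∈ Set.Icc (-1:ℝ) 1 := ⟨hx.1.le, hx.2.le⟩
    have hz : 0 < 1 - x ^ 2 := by nlinarith [hx.1, hx.2]
    obtain ⟨b1, b2⟩ := hc M x (abs_lt.2 hx)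
    set F := ∑ k ∈ range M, c k * (x ^ 2) ^ k
    have hw : √(wG lam x) = √(wG 0 x) * (κ * (1 - x ^ 2) ^ (lam / 2)) := by
      rw [hκ, ← Real.sqrt_sq (Real.rpow_nonneg hz.le (lam / 2)), ← Real.sqrt_mul (by
        have := cwG_pos lam hlam; have := cwG_pos 0 (by norm_num); positivity), ← Real.sqrt_mul (wG_nonneg 0 (by norm_num) hx')]
      congr 1
      have hq : ((1 - x ^ 2) ^ (lam / 2)) ^ 2 = (1 - x ^ 2) ^ lam := by
        rw [← Real.rpow_mul_natCast hz.le]; congr 1; push_cast; ring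
      rw [hq, wG_eq, wG_eq, show lam - 1/2 = (0 - 1/2) + lam by ring, Real.rpow_add hz]
      have := (cwG_pos 0 (by norm_num)).ne'
      field_simp
    have hs2 : (1 - x ^ 2) ^ s = (1 - x ^ 2) * (1 - x ^ 2) ^ (lam / 2) := by
      rw [hs, Real.rpow_add hz, Real.rpow_one]
    have e : wQ j x - tT j x * (κ⁻¹ * ((1 - x ^ 2) * F)) * √(wG lam x) = tT j x * √(wG 0 x) * (1 - (1 - x ^ 2) ^ s * F) := by
      rw [hw, hs2]; unfold wQ
      have : κ⁻¹ * κ = 1 := inv_mul_cancel₀ hκ0.ne'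
      linear_combination (-tT j x * √(wG 0 x) * (1 - x^2) * (1 - x ^ 2) ^ (lam / 2) * F) * this
    rw [e, mul_pow, mul_pow, Real.sq_sqrt (wG_nonneg 0 (by norm_num) hx')]
    have h1 : (1 - (1 - x ^ 2) ^ s * F) ^ 2 ≤ (2 ^ s * |x| ^ M) ^ 2 := by gcongr
    have h2 : (2 ^ s * |x| ^ M) ^ 2 = (2 ^ s) ^ 2 * x ^ (2 * M) := by
      rw [mul_pow, ← pow_mul, mul_comm M 2, pow_mul |x|, sq_abs, ← pow_mul]
    rw [h2] at h1
    have h3 := wG_nonneg 0 (by norm_num) hx'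
    calc _ ≤ 2 * wG 0 x * ((2 ^ s) ^ 2 * x ^ (2 * M)) := by
          gcongr
          exact tT_sq_le j hx'
      _ = _ := by ring
  have hI := (int_cont 0 (by norm_num) (f := fun x => x ^ (2 * M)) (by fun_prop)).const_mul (2 * (2 ^ s) ^ 2)
  calc _ ≤ ∫ x in Set.Icc (-1:ℝ) 1, 2 * (2 ^ s) ^ 2 * (x ^ (2 * M) * wG 0 x) := by
        refine integral_mono_of_nonneg (Filter.Eventually.of_forall fun x => sq_nonneg _) hI ?_
        rw [← restrict_Ioo_eq_restrict_Icc]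
        filter_upwards [ae_restrict_mem measurableSet_Ioo] with x hx using hbd x hx
    _ = 2 * (2 ^ s) ^ 2 * (π⁻¹ * ∫ θ in (0:ℝ)..π, cos θ ^ (2 * M)) := by
        rw [integral_const_mul, int_wG_zero (fun x => x ^ (2 * M))]
    _ ≤ 2 * (2 ^ s) ^ 2 * (π⁻¹ * (π / √(M + 1))) := by
        have := cos_pow_bound M
        have := Real.pi_pos
        gcongr
    _ = _ := by have := Real.pi_pos; field_simp

lemma D_bound (lam : ℝ) (hlam : -(1 / 2) < lam) (h0 : lam ≠ 0) : ∃ C : ℝ, 0 ≤ C ∧ ∀ n : ℕ, 1 ≤ n →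
    Integrable (fun p => ker2 (wP lam) (n + 1) p ^ 2 - ker2 wQ (n + 1) p ^ 2)
      ((volume.restrict (Set.Icc (-1:ℝ) 1)).prod (volume.restrict (Set.Icc (-1:ℝ) 1))) ∧
    ∫ p, |ker2 (wP lam) (n + 1) p ^ 2 - ker2 wQ (n + 1) p ^ 2|
      ∂((volume.restrict (Set.Icc (-1:ℝ) 1)).prod (volume.restrict (Set.Icc (-1:ℝ) 1))) ≤ C * (n:ℝ) ^ (7/8 : ℝ) := by
  obtain ⟨C, hC, h⟩ := approx lam hlam h0
  refine ⟨2 * C + 8, by positivity, fun n hn => ?_⟩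
  have hn1 : (1:ℝ) ≤ n := by exact_mod_cast hn
  have hn0 : (0:ℝ) < n := by linarith
  set r := (n:ℝ) ^ (1/8 : ℝ) with hr
  have hr0 : 0 < r := by positivity
  have hr1 : 1 ≤ r := Real.one_le_rpow hn1 (by norm_num)
  have hpow : ∀ k : ℕ, r ^ k = (n:ℝ) ^ ((k:ℝ) / 8) := by
    intro k; rw [hr, ← Real.rpow_mul_natCast hn0.le]; congr 1; ring
  have hr8 : r ^ 8 = n := by rw [hpow]; norm_num
  have hr7 : (n:ℝ) ^ (7/8 : ℝ) = r ^ 7 := by rw [hpow]; norm_num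
  obtain ⟨h1, h2⟩ := ker2_diff (volume.restrict (Set.Icc (-1:ℝ) 1)) (wP lam) wQ (wP_mem lam hlam) wQ_mem (wP_orth lam hlam h0)
    wQ_orth (n + 1) (2 * Nat.sqrt n + 2) (C / √((Nat.sqrt n : ℝ) + 1)) (fun j hj => h (Nat.sqrt n) j (n + 1) hj) (by positivity) (1 / r) (by positivity)
  refine ⟨h1, h2.trans ?_⟩
  have s1 : (Nat.sqrt n : ℝ) ≤ r ^ 4 := by
    rw [← pow_le_pow_iff_left₀ (by positivity) (by positivity) two_ne_zero, ← pow_mul, hr8]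
    exact_mod_cast Nat.sqrt_le' n
  have s2 : r ^ 2 ≤ √((Nat.sqrt n : ℝ) + 1) := by
    apply Real.le_sqrt_of_sq_le
    rw [← pow_le_pow_iff_left₀ (by positivity) (by positivity) two_ne_zero, ← pow_mul, ← pow_mul, hr8]
    exact_mod_cast (Nat.lt_succ_sqrt' n).le
  have s3 : C / √((Nat.sqrt n : ℝ) + 1) ≤ C / r ^ 2 := by gcongr
  rw [hr7]
  push_cast
  rw [one_div, inv_inv, ← hr8]
  have p1 : (1:ℝ) ≤ r ^ 8 := one_le_pow₀ hr1
  have p4 : (1:ℝ) ≤ r ^ 4 := one_le_pow₀ hr1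
  have p46 : r ^ 4 ≤ r ^ 6 := pow_le_pow_right₀ hr1 (by norm_num)
  calc _ ≤ r * ((r ^ 8 + r ^ 8) * (C / r ^ 2) + (2 * r ^ 6 + 2 * r ^ 6)) + 2 * r⁻¹ * (r ^ 8 + r ^ 8) := by
        gcongr
        · linarith
        · linarith
    _ = _ := by field_simp; ring

lemma Geg_bound (lam : ℝ) : ∃ A : ℝ, 0 ≤ A ∧ ∃ K : ℕ, ∀ n : ℕ, ∀ x ∈ Set.Icc (-1:ℝ) 1, |Geg lam n x| ≤ A * ((n:ℝ) + 1) ^ K := by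
  obtain ⟨K, hK⟩ := exists_nat_ge (2 * |lam - 1|)
  refine ⟨1 + 2 * |lam|, by positivity, K + 1, fun n x hx => ?_⟩
  have hx2 : x ^ 2 ≤ 1 := by nlinarith [hx.1, hx.2]
  have hE : ∀ n : ℕ, (Geg lam (n + 1) x - x * Geg lam n x) ^ 2 + (1 - x ^ 2) * Geg lam n x ^ 2 ≤
      ((1 + 2 * |lam|) * ((n:ℝ) + 2) ^ K) ^ 2 := by
    intro n
    induction n with
    | zero =>
      simp only [Geg_zero, Geg_one, zero_add]
      have h1 : (1:ℝ) ≤ 2 ^ K := one_le_pow₀ (by norm_num)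
      have h2 : (2 * lam * x - x * 1) ^ 2 + (1 - x ^ 2) * 1 ^ 2 ≤ (1 + 2 * |lam|) ^ 2 := by
        have h3 := abs_le.1 (le_refl |lam|)
        have h4 := sq_abs lam
        have h5 : 0 ≤ |lam| := abs_nonneg _
        nlinarith [mul_nonneg (sq_nonneg lam) (sub_nonneg.2 hx2), mul_nonneg h5 (sub_nonneg.2 hx2), mul_nonneg (by linarith : 0 ≤ |lam| + lam) (sq_nonneg x)]
      refine h2.trans ?_
      simp only [Nat.cast_zero, zero_add]
      gcongr
      nlinarith [abs_nonneg lam]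
    | succ n ih =>
      set a := Geg lam (n + 1) x
      set b := Geg lam n x
      have hr := Geg_rec lam n x
      set δ := 2 * (lam - 1) / ((n:ℝ) + 2) with hδ
      have hn2 : (0:ℝ) < (n:ℝ) + 2 := by positivity
      have e : Geg lam (n + 1 + 1) x - x * a = (1 + δ) * (x * a - b) := by
        have : Geg lam (n + 1 + 1) x = (2 * ((n:ℝ) + 1 + lam) * x * a - (n + 2 * lam) * b) / (n + 2) := by
          rw [eq_div_iff hn2.ne']; linarith
        rw [this, hδ]; field_simp; ring
      have hd : |1 + δ| ≤ 1 + K * (1 / ((n:ℝ) + 2)) := by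
        refine (abs_add_le _ _).trans ?_
        rw [abs_one, hδ, abs_div, abs_mul, abs_of_pos hn2, abs_two, mul_one_div]
        gcongr
      have hd2 : 1 + K * (1 / ((n:ℝ) + 2)) ≤ (1 + 1 / ((n:ℝ) + 2)) ^ K :=
        one_add_mul_le_pow (by have : 0 ≤ 1 / ((n:ℝ)+2) := by positivity
                               linarith) K
      have hd3 : (1 + 1 / ((n:ℝ) + 2)) = ((n:ℝ) + 3) / (n + 2) := by field_simp; ring
      rw [hd3] at hd2
      have hq1 : 1 ≤ (((n:ℝ) + 3) / (n + 2)) ^ K := one_le_pow₀ (by rw [one_le_div hn2]; linarith)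
      set q := (((n:ℝ) + 3) / (n + 2)) ^ K with hq
      have hq2 : (1 + δ) ^ 2 ≤ q ^ 2 := by rw [← sq_abs]; gcongr; linarith
      have hz : 0 ≤ (1 - x ^ 2) * a ^ 2 := mul_nonneg (by linarith) (sq_nonneg _)
      have eid : (x * a - b) ^ 2 + (1 - x ^ 2) * a ^ 2 = (a - x * b) ^ 2 + (1 - x ^ 2) * b ^ 2 := by ring
      rw [e]
      calc ((1 + δ) * (x * a - b)) ^ 2 + (1 - x ^ 2) * a ^ 2 ≤ q ^ 2 * (x * a - b) ^ 2 + q ^ 2 * ((1 - x ^ 2) * a ^ 2) := by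
            rw [mul_pow]
            have h1 : 1 * ((1 - x ^ 2) * a ^ 2) ≤ q ^ 2 * ((1 - x ^ 2) * a ^ 2) := by
              gcongr; exact one_le_pow₀ hq1
            have h2 : (1 + δ) ^ 2 * (x * a - b) ^ 2 ≤ q ^ 2 * (x * a - b) ^ 2 := by gcongr
            linarith
        _ = q ^ 2 * ((a - x * b) ^ 2 + (1 - x ^ 2) * b ^ 2) := by rw [← eid]; ring
        _ ≤ q ^ 2 * ((1 + 2 * |lam|) * ((n:ℝ) + 2) ^ K) ^ 2 := by gcongr
        _ = _ := by
          rw [hq, ← mul_pow]; push_cast; rw [div_pow]; field_simp; ring_nf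
  induction n with
  | zero => simp [Geg_zero]
  | succ n ih =>
    have h1 : |Geg lam (n + 1) x - x * Geg lam n x| ≤ (1 + 2 * |lam|) * ((n:ℝ) + 2) ^ K := by
      apply abs_le_of_sq_le_sq
      · have := hE n
        have h3 : 0 ≤ (1 - x ^ 2) * Geg lam n x ^ 2 := mul_nonneg (by linarith) (sq_nonneg _)
        linarith
      · positivity
    have h2 : |x * Geg lam n x| ≤ |Geg lam n x| := by
      rw [abs_mul]; exact mul_le_of_le_one_left (abs_nonneg _) (abs_le.2 hx)
    have h3 : |Geg lam (n + 1) x| ≤ |Geg lam (n + 1) x - x * Geg lam n x| + |x * Geg lam n x| := by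
      have := abs_add_le (Geg lam (n + 1) x - x * Geg lam n x) (x * Geg lam n x)
      simpa using this
    have h4 : ((n:ℝ) + 1) ^ (K + 1) ≤ (n + 2) ^ K * (n + 1) := by
      rw [pow_succ]; gcongr; linarith
    have h5 : (1 + 2 * |lam|) * ((n:ℝ) + 1) ^ (K + 1) ≤ (1 + 2 * |lam|) * ((n + 2) ^ K * (n + 1)) := by gcongr
    push_cast
    rw [show (n:ℝ) + 1 + 1 = n + 2 by ring, pow_succ]
    linarith

lemma gamG_bound (lam : ℝ) (hlam : -(1 / 2) < lam) (h0 : lam ≠ 0) : ∃ A : ℝ, 0 ≤ A ∧ ∀ n : ℕ, gamG lam n ^ 2 ≤ A * ((n:ℝ) + 1) ^ 4 := by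
  have hrec : ∀ n : ℕ, gamG lam (n + 1) ^ 2 * ((n + lam) * (n + 2 * lam)) = gamG lam n ^ 2 * ((n + 1) * (n + 1 + lam)) := by
    intro n
    have hnr := Geg_norm_rec lam hlam n
    have h1 := (gamG_sq lam hlam h0 n).2
    have h2 := (gamG_sq lam hlam h0 (n + 1)).2
    set I0 := (∫ x in Set.Icc (-1:ℝ) 1, (Geg lam n x * Geg lam n x) * wG lam x)
    set I1 := (∫ x in Set.Icc (-1:ℝ) 1, (Geg lam (n+1) x * Geg lam (n+1) x) * wG lam x)
    linear_combination (gamG lam n ^ 2 * ((n + 1) * (n + 1 + lam))) * h2 - (gamG lam n ^ 2 * gamG lam (n+1) ^ 2) * hnr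
      - (gamG lam (n + 1) ^ 2 * ((n + lam) * (n + 2 * lam))) * h1
  have hb : ∀ k : ℕ, gamG lam (k + 2) ^ 2 ≤ gamG lam 2 ^ 2 * ((k + 2) * (k + 1)) ^ 2 := by
    intro k
    induction k with
    | zero => simp; nlinarith [sq_nonneg (gamG lam 2)]
    | succ k ih =>
      have hr := hrec (k + 2)
      push_cast at hr ⊢
      have hk : (0:ℝ) ≤ k := by positivity
      have l1 : 0 < (k:ℝ) + 2 + lam := by linarith
      have l2 : (k:ℝ) + 1 < k + 2 + 2 * lam := by linarith
      have l3 : ((k:ℝ) + 2 + 1 + lam) * (k + 1) ≤ (k + 3) * (k + 2 + lam) := by nlinarith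
      set X := gamG lam (k + 2 + 1) ^ 2 with hX
      set Y := gamG lam (k + 2) ^ 2 with hY
      have hX0 : 0 ≤ X := sq_nonneg _
      have hY0 : 0 ≤ Y := sq_nonneg _
      have h4 : X * ((k:ℝ) + 1) ^ 2 ≤ Y * ((k:ℝ) + 3) ^ 2 := by
        have h5 : (X * ((k:ℝ) + 1) ^ 2) * (k + 2 + lam) ≤ (Y * ((k:ℝ) + 3) ^ 2) * (k + 2 + lam) := by
          calc (X * ((k:ℝ) + 1) ^ 2) * (k + 2 + lam) = X * ((k + 2 + lam) * (k + 1)) * (k + 1) := by ring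
            _ ≤ X * ((k + 2 + lam) * (k + 2 + 2 * lam)) * (k + 1) := by gcongr
            _ = Y * (k + 3) * (((k:ℝ) + 2 + 1 + lam) * (k + 1)) := by rw [hr]; ring
            _ ≤ Y * (k + 3) * ((k + 3) * (k + 2 + lam)) := by gcongr
            _ = _ := by ring
        exact le_of_mul_le_mul_right h5 l1
      have h6 : X * ((k:ℝ) + 1) ^ 2 ≤ (gamG lam 2 ^ 2 * ((k + 1 + 2) * (k + 1 + 1)) ^ 2) * ((k:ℝ) + 1) ^ 2 := by
        calc _ ≤ Y * ((k:ℝ) + 3) ^ 2 := h4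
          _ ≤ (gamG lam 2 ^ 2 * ((k + 2) * (k + 1)) ^ 2) * ((k:ℝ) + 3) ^ 2 := by gcongr
          _ = _ := by ring
      exact le_of_mul_le_mul_right h6 (by positivity)
  refine ⟨gamG lam 0 ^ 2 + gamG lam 1 ^ 2 + gamG lam 2 ^ 2, by positivity, fun n => ?_⟩
  have h1 : (1:ℝ) ≤ ((n:ℝ) + 1) ^ 4 := one_le_pow₀ (by linarith [(by positivity : (0:ℝ) ≤ n)])
  rcases n with _ | _ | k
  · simp only [Nat.cast_zero, zero_add, one_pow, mul_one]
    nlinarith [sq_nonneg (gamG lam 0), sq_nonneg (gamG lam 1), sq_nonneg (gamG lam 2)]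
  · simp only [zero_add] at h1 ⊢
    nlinarith [sq_nonneg (gamG lam 0), sq_nonneg (gamG lam 1), sq_nonneg (gamG lam 2)]
  · refine (hb k).trans ?_
    push_cast
    have : (((k:ℝ) + 2) * (k + 1)) ^ 2 ≤ (k + 1 + 1 + 1) ^ 4 := by
      rw [show ((k:ℝ) + 1 + 1 + 1) ^ 4 = ((k + 3) * (k + 3)) ^ 2 by ring]
      gcongr <;> linarith
    gcongr
    nlinarith [sq_nonneg (gamG lam 0), sq_nonneg (gamG lam 1), sq_nonneg (gamG lam 2)]

lemma ker_bound (f : ℕ → ℝ → ℝ) (w : ℝ → ℝ) (hw : ∀ x ∈ Set.Icc (-1:ℝ) 1, 0 ≤ w x) (A : ℝ) (hA : 0 ≤ A) (K : ℕ)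
    (hf : ∀ n : ℕ, ∀ x ∈ Set.Icc (-1:ℝ) 1, f n x ^ 2 ≤ A * ((n:ℝ) + 1) ^ K) (n : ℕ) (p : ℝ × ℝ)
    (hp : p ∈ Set.Icc (-1:ℝ) 1 ×ˢ Set.Icc (-1:ℝ) 1) :
    ker2 (fun i x => f i x * √(w x)) (n + 1) p ^ 2 = (∑ i ∈ range (n + 1), f i p.1 * f i p.2) ^ 2 * (w p.1 * w p.2) ∧
    ker2 (fun i x => f i x * √(w x)) (n + 1) p ^ 2 ≤ A ^ 2 * ((n:ℝ) + 1) ^ (2 * K + 2) * (w p.1 * w p.2) := by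
  have e : ker2 (fun i x => f i x * √(w x)) (n + 1) p ^ 2 = (∑ i ∈ range (n + 1), f i p.1 * f i p.2) ^ 2 * (w p.1 * w p.2) := by
    have : ker2 (fun i x => f i x * √(w x)) (n + 1) p = (∑ i ∈ range (n + 1), f i p.1 * f i p.2) * (√(w p.1) * √(w p.2)) := by
      unfold ker2; rw [sum_mul]; exact sum_congr rfl fun i _ => by ring
    rw [this, mul_pow, mul_pow, Real.sq_sqrt (hw _ hp.1), Real.sq_sqrt (hw _ hp.2)]
  refine ⟨e, ?_⟩
  rw [e]
  have h1 : |∑ i ∈ range (n + 1), f i p.1 * f i p.2| ≤ ∑ i ∈ range (n + 1), A * ((n:ℝ) + 1) ^ K := by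
    refine (abs_sum_le_sum_abs _ _).trans (sum_le_sum fun i hi => ?_)
    have h2 := hf i _ hp.1
    have h3 := hf i _ hp.2
    have hin : (i:ℝ) ≤ n := by exact_mod_cast Nat.lt_succ_iff.1 (mem_range.1 hi)
    have h4 : A * ((i:ℝ) + 1) ^ K ≤ A * ((n:ℝ) + 1) ^ K := by gcongr
    rw [abs_mul]
    nlinarith [sq_abs (f i p.1), sq_abs (f i p.2), sq_nonneg (|f i p.1| - |f i p.2|)]
  rw [sum_const, card_range, nsmul_eq_mul] at h1
  push_cast at h1
  have h5 : (∑ i ∈ range (n + 1), f i p.1 * f i p.2) ^ 2 ≤ (((n:ℝ) + 1) * (A * ((n:ℝ) + 1) ^ K)) ^ 2 := by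
    rw [← sq_abs]; gcongr
  have h6 := hw _ hp.1
  have h7 := hw _ hp.2
  calc _ ≤ (((n:ℝ) + 1) * (A * ((n:ℝ) + 1) ^ K)) ^ 2 * (w p.1 * w p.2) := by gcongr
    _ = _ := by ring

lemma GegHat_bound (lam : ℝ) (hlam : -(1 / 2) < lam) (h0 : lam ≠ 0) : ∃ A : ℝ, 0 ≤ A ∧ ∃ K : ℕ, ∀ n : ℕ, ∀ x ∈ Set.Icc (-1:ℝ) 1,
    GegHat lam n x ^ 2 ≤ A * ((n:ℝ) + 1) ^ K := by
  obtain ⟨A, hA, K, h1⟩ := Geg_bound lam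
  obtain ⟨B, hB, h2⟩ := gamG_bound lam hlam h0
  refine ⟨B * A ^ 2, by positivity, 2 * K + 4, fun n x hx => ?_⟩
  have h3 := h1 n x hx
  have h4 := h2 n
  unfold GegHat
  rw [mul_pow]
  have h5 : Geg lam n x ^ 2 ≤ (A * ((n:ℝ) + 1) ^ K) ^ 2 := by rw [← sq_abs]; gcongr
  calc _ ≤ (B * ((n:ℝ) + 1) ^ 4) * (A * ((n:ℝ) + 1) ^ K) ^ 2 := by gcongr
    _ = _ := by ring

lemma abs_rpow_int (t : ℝ) (ht : t < 1) : IntegrableOn (fun u : ℝ => |u| ^ (-t)) (Set.Icc (-2) 2) := by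
  rw [← intervalIntegrable_iff_integrableOn_Icc_of_le (by norm_num)]
  apply intervalIntegrable_of_even
  · intro x; simp
  · intro x hx
    refine (intervalIntegral.intervalIntegrable_rpow' (by linarith : -1 < -t) (a := 0) (b := x)).congr ?_
    intro u hu
    rw [Set.uIoc_of_le hx.le] at hu
    simp only
    rw [abs_of_pos hu.1]
  all_goals exact enorm_ne_top

lemma conv_int (g : ℝ → ℝ) (hg : IntegrableOn g (Set.Icc (-1:ℝ) 1)) (t : ℝ) (ht : t < 1) :
    Integrable (fun p : ℝ × ℝ => g p.2 * |p.1 - p.2| ^ (-t))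
      ((volume.restrict (Set.Icc (-1:ℝ) 1)).prod (volume.restrict (Set.Icc (-1:ℝ) 1))) := by
  have h1 : Integrable ((Set.Icc (-1:ℝ) 1).indicator g) := hg.integrable_indicator measurableSet_Icc
  have h2 : Integrable ((Set.Icc (-2:ℝ) 2).indicator (fun u : ℝ => |u| ^ (-t))) :=
    (abs_rpow_int t ht).integrable_indicator measurableSet_Icc
  have h3 := (Integrable.convolution_integrand (ContinuousLinearMap.mul ℝ ℝ) h1 h2).integrableOn
    (s := Set.Icc (-1:ℝ) 1 ×ˢ Set.Icc (-1:ℝ) 1)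
  rw [Measure.prod_restrict]
  refine h3.congr_fun ?_ (measurableSet_Icc.prod measurableSet_Icc)
  intro p hp
  simp only [ContinuousLinearMap.mul_apply']
  rw [Set.indicator_of_mem hp.2, Set.indicator_of_mem]
  have := hp.1; have := hp.2
  simp only [Set.mem_Icc] at *
  constructor <;> linarith

lemma log_int (lam : ℝ) (hlam : -(1 / 2) < lam) : ∃ s0 : ℝ, 0 < s0 ∧ ∀ s, 0 < s → s ≤ s0 →
    Integrable (fun p : ℝ × ℝ => (wG lam p.1 * wG lam p.2) * |p.1 - p.2| ^ (-s))
      ((volume.restrict (Set.Icc (-1:ℝ) 1)).prod (volume.restrict (Set.Icc (-1:ℝ) 1))) := by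
  set α := lam - 1/2 with hα
  set p := (3 + α) / 2 with hp
  have hp1 : 1 < p := by rw [hp]; linarith
  set q := Real.conjExponent p with hq
  have hpq := Real.HolderConjugate.conjExponent hp1
  have hq0 : 1 < q := hpq.symm.lt
  have hwp : IntegrableOn (fun x => wG lam x ^ p) (Set.Icc (-1:ℝ) 1) := by
    have h1 := (int_w (α * p) (by rw [hp]; nlinarith)).1.const_mul (cwG lam ^ p)
    refine IntegrableOn.congr_fun h1 ?_ measurableSet_Icc
    intro x hx
    have hx0 : 0 ≤ 1 - x ^ 2 := by nlinarith [hx.1, hx.2]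
    simp only
    rw [wG_eq, Real.mul_rpow (cwG_pos lam hlam).le (Real.rpow_nonneg hx0 _), ← Real.rpow_mul hx0]
  have hw := (wG_int_one lam hlam).1
  refine ⟨1 / (2 * q), by positivity, fun s hs hs0 => ?_⟩
  have hsq : s * q ≤ 1 / 2 := by
    calc s * q ≤ 1 / (2 * q) * q := by gcongr
      _ = 1 / 2 := by field_simp
  have I1 : Integrable (fun z : ℝ × ℝ => wG lam z.1 ^ p * wG lam z.2)
      ((volume.restrict (Set.Icc (-1:ℝ) 1)).prod (volume.restrict (Set.Icc (-1:ℝ) 1))) := Integrable.mul_prod hwp hw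
  have I2 := conv_int (wG lam) hw (s * q) (by linarith)
  have hm : Measurable (fun p : ℝ × ℝ => (wG lam p.1 * wG lam p.2) * |p.1 - p.2| ^ (-s)) := by
    have := wG_meas lam
    fun_prop
  refine (I1.add I2).mono' hm.aestronglyMeasurable ?_
  rw [Measure.prod_restrict]
  filter_upwards [ae_restrict_mem (measurableSet_Icc.prod measurableSet_Icc)] with z hz
  have w1 := wG_nonneg lam hlam hz.1
  have w2 := wG_nonneg lam hlam hz.2
  have u0 : 0 ≤ |z.1 - z.2| ^ (-s) := by positivity
  rw [Real.norm_of_nonneg (by positivity)]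
  simp only [Pi.add_apply]
  have hy := Real.young_inequality_of_nonneg w1 u0 hpq
  have e : (|z.1 - z.2| ^ (-s)) ^ q = |z.1 - z.2| ^ (-(s * q)) := by
    rw [← Real.rpow_mul (abs_nonneg _)]; congr 1; ring
  rw [← hq, e] at hy
  have hy2 : wG lam z.1 * |z.1 - z.2| ^ (-s) ≤ wG lam z.1 ^ p + |z.1 - z.2| ^ (-(s * q)) := by
    refine hy.trans (add_le_add (div_le_self (by positivity) hp1.le) (div_le_self (by positivity) hq0.le))
  nlinarith [mul_le_mul_of_nonneg_left hy2 w2]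

lemma log_trunc (s L u : ℝ) (hs : 0 < s) (hL : log 2 ≤ L) (hu : u ≤ 2) (hu0 : 0 ≤ u) :
    |log (1 / u)| ≤ L + (1 / s) * exp (-(L * s)) * u ^ (-s) := by
  have hl2 : 0 < log 2 := Real.log_pos (by norm_num)
  rcases hu0.eq_or_lt with h | h
  · rw [← h]
    have h0 : 0 ≤ (1 / s) * exp (-(L * s)) * (0:ℝ) ^ (-s) := by positivity
    rw [div_zero, Real.log_zero, abs_zero]
    linarith
  · have hpos : 0 ≤ (1 / s) * exp (-(L * s)) * u ^ (-s) := by positivity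
    rw [abs_le]
    constructor
    · rw [one_div u, Real.log_inv]
      have := Real.log_le_log h hu
      linarith
    · have h1 := Real.log_le_rpow_div (x := (1 / u) * exp (-L)) (by positivity) hs
      rw [Real.log_mul (by positivity) (by positivity), Real.log_exp, Real.mul_rpow (by positivity) (by positivity),
        ← Real.exp_mul, one_div u, Real.inv_rpow hu0, ← Real.rpow_neg hu0] at h1
      rw [one_div u]
      have e : u ^ (-s) * exp (-L * s) / s = (1 / s) * exp (-(L * s)) * u ^ (-s) := by
        rw [neg_mul]; ring
      linarith

noncomputable def mI : Measure ℝ := volume.restrict (Set.Icc (-1:ℝ) 1)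

lemma ker_pow_int (lam : ℝ) (hlam : -(1 / 2) < lam) (f : ℕ → ℝ → ℝ) (hfc : ∀ n, Continuous (f n)) (A : ℝ) (hA : 0 ≤ A)
    (K : ℕ) (hf : ∀ n : ℕ, ∀ x ∈ Set.Icc (-1:ℝ) 1, f n x ^ 2 ≤ A * ((n:ℝ) + 1) ^ K) (s : ℝ)
    (hs : Integrable (fun p : ℝ × ℝ => (wG lam p.1 * wG lam p.2) * |p.1 - p.2| ^ (-s))
      ((volume.restrict (Set.Icc (-1:ℝ) 1)).prod (volume.restrict (Set.Icc (-1:ℝ) 1)))) (n : ℕ) :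
    Integrable (fun p => ker2 (fun i x => f i x * √(wG lam x)) (n + 1) p ^ 2 * |p.1 - p.2| ^ (-s))
      ((volume.restrict (Set.Icc (-1:ℝ) 1)).prod (volume.restrict (Set.Icc (-1:ℝ) 1))) ∧
    ∫ p, ker2 (fun i x => f i x * √(wG lam x)) (n + 1) p ^ 2 * |p.1 - p.2| ^ (-s)
      ∂((volume.restrict (Set.Icc (-1:ℝ) 1)).prod (volume.restrict (Set.Icc (-1:ℝ) 1))) ≤
      A ^ 2 * ((n:ℝ) + 1) ^ (2 * K + 2) * ∫ p : ℝ × ℝ, (wG lam p.1 * wG lam p.2) * |p.1 - p.2| ^ (-s)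
      ∂((volume.restrict (Set.Icc (-1:ℝ) 1)).prod (volume.restrict (Set.Icc (-1:ℝ) 1))) := by
  have hm : Measurable (fun p : ℝ × ℝ => ker2 (fun i x => f i x * √(wG lam x)) (n + 1) p ^ 2 * |p.1 - p.2| ^ (-s)) := by
    have h1 := wG_meas lam
    have h2 := fun n => (hfc n).measurable
    unfold ker2
    fun_prop
  have hb : ∀ᵐ p ∂((volume.restrict (Set.Icc (-1:ℝ) 1)).prod (volume.restrict (Set.Icc (-1:ℝ) 1))),
      ker2 (fun i x => f i x * √(wG lam x)) (n + 1) p ^ 2 * |p.1 - p.2| ^ (-s) ≤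
      A ^ 2 * ((n:ℝ) + 1) ^ (2 * K + 2) * ((wG lam p.1 * wG lam p.2) * |p.1 - p.2| ^ (-s)) := by
    rw [Measure.prod_restrict]
    filter_upwards [ae_restrict_mem (measurableSet_Icc.prod measurableSet_Icc)] with z hz
    have := (ker_bound f (wG lam) (fun x hx => wG_nonneg lam hlam hx) A hA K hf n z hz).2
    rw [← mul_assoc]
    gcongr
  have hi : Integrable (fun p => ker2 (fun i x => f i x * √(wG lam x)) (n + 1) p ^ 2 * |p.1 - p.2| ^ (-s))
      ((volume.restrict (Set.Icc (-1:ℝ) 1)).prod (volume.restrict (Set.Icc (-1:ℝ) 1))) := by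
    refine (hs.const_mul (A ^ 2 * ((n:ℝ) + 1) ^ (2 * K + 2))).mono' hm.aestronglyMeasurable ?_
    filter_upwards [hb] with z hz
    rw [Real.norm_of_nonneg (by positivity)]
    exact hz
  refine ⟨hi, ?_⟩
  rw [← integral_const_mul]
  exact integral_mono_ae hi (hs.const_mul _) hb

lemma ker_log_int (lam : ℝ) (hlam : -(1 / 2) < lam) (f : ℕ → ℝ → ℝ) (hfc : ∀ n, Continuous (f n)) (A : ℝ) (hA : 0 ≤ A)
    (K : ℕ) (hf : ∀ n : ℕ, ∀ x ∈ Set.Icc (-1:ℝ) 1, f n x ^ 2 ≤ A * ((n:ℝ) + 1) ^ K) (n : ℕ) :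
    Integrable (fun p => ker2 (fun i x => f i x * √(wG lam x)) (n + 1) p ^ 2 * log (1 / |p.1 - p.2|))
      ((volume.restrict (Set.Icc (-1:ℝ) 1)).prod (volume.restrict (Set.Icc (-1:ℝ) 1))) := by
  obtain ⟨s, hs0, hs⟩ := log_int lam hlam
  have h1 := (ker_pow_int lam hlam f hfc A hA K hf s (hs s hs0 le_rfl) n).1
  have h0 : Integrable (fun p : ℝ × ℝ => (wG lam p.1 * wG lam p.2) * |p.1 - p.2| ^ (-(0:ℝ)))
      ((volume.restrict (Set.Icc (-1:ℝ) 1)).prod (volume.restrict (Set.Icc (-1:ℝ) 1))) := by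
    simp only [neg_zero, Real.rpow_zero, mul_one]
    exact Integrable.mul_prod (wG_int_one lam hlam).1 (wG_int_one lam hlam).1
  have h2 := (ker_pow_int lam hlam f hfc A hA K hf 0 h0 n).1
  simp only [neg_zero, Real.rpow_zero, mul_one] at h2
  have hm : Measurable (fun p : ℝ × ℝ => ker2 (fun i x => f i x * √(wG lam x)) (n + 1) p ^ 2 * log (1 / |p.1 - p.2|)) := by
    have h1 := wG_meas lam
    have h2 := fun n => (hfc n).measurable
    unfold ker2
    fun_prop
  refine ((h2.mul_const (log 2)).add (h1.const_mul (1 / s * exp (-(log 2 * s))))).mono' hm.aestronglyMeasurable ?_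
  rw [Measure.prod_restrict]
  filter_upwards [ae_restrict_mem (measurableSet_Icc.prod measurableSet_Icc)] with z hz
  rw [norm_mul, Real.norm_of_nonneg (by positivity), Real.norm_eq_abs]
  simp only [Pi.add_apply]
  have hu : |z.1 - z.2| ≤ 2 := by
    have := hz.1; have := hz.2
    simp only [Set.mem_Icc] at *
    rw [abs_le]; constructor <;> linarith
  have := mul_le_mul_of_nonneg_left (log_trunc s (log 2) _ hs0 le_rfl hu (abs_nonneg _))
    (sq_nonneg (ker2 (fun i x => f i x * √(wG lam x)) (n + 1) z))
  linarith

noncomputable def L20 (n : ℕ) : ℝ := ∫ p, ker2 wQ (n + 1) p ^ 2 * log (1 / |p.1 - p.2|)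
      ∂((volume.restrict (Set.Icc (-1:ℝ) 1)).prod (volume.restrict (Set.Icc (-1:ℝ) 1)))

lemma L2_eq (lam : ℝ) (hlam : -(1 / 2) < lam) (h0 : lam ≠ 0) (n : ℕ) :
    L2 lam n = ∫ p, ker2 (wP lam) (n + 1) p ^ 2 * log (1 / |p.1 - p.2|)
      ∂((volume.restrict (Set.Icc (-1:ℝ) 1)).prod (volume.restrict (Set.Icc (-1:ℝ) 1))) := by
  obtain ⟨A, hA, K, hK⟩ := GegHat_bound lam hlam h0
  have hi := ker_log_int lam hlam (GegHat lam) (GegHat_cont lam) A hA K hK n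
  change L2 lam n = ∫ p, ker2 (fun i x => GegHat lam i x * √(wG lam x)) (n + 1) p ^ 2 * log (1 / |p.1 - p.2|)
      ∂((volume.restrict (Set.Icc (-1:ℝ) 1)).prod (volume.restrict (Set.Icc (-1:ℝ) 1)))
  rw [integral_prod _ hi]
  unfold L2
  refine setIntegral_congr_fun measurableSet_Icc fun x hx => ?_
  refine setIntegral_congr_fun measurableSet_Icc fun y hy => ?_
  have := (ker_bound (GegHat lam) (wG lam) (fun x hx => wG_nonneg lam hlam hx) A hA K hK n (x, y) ⟨hx, hy⟩).1
  simp only at this ⊢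
  rw [this, KG]
  ring

lemma L2_diff (lam : ℝ) (hlam : -(1 / 2) < lam) (h0 : lam ≠ 0) :
    ∃ C1 C2 : ℝ, ∀ n : ℕ, 2 ≤ n → |L2 lam n - L20 n| ≤ C1 * log n * (n:ℝ) ^ (7/8 : ℝ) + C2 := by
  obtain ⟨A, hA, K, hK⟩ := GegHat_bound lam hlam h0
  obtain ⟨s1, hs1, h1⟩ := log_int lam hlam
  obtain ⟨s2, hs2, h2⟩ := log_int 0 (by norm_num)
  obtain ⟨C, hC, hD⟩ := D_bound lam hlam h0
  have hT : ∀ n : ℕ, ∀ x ∈ Set.Icc (-1:ℝ) 1, tT n x ^ 2 ≤ 2 * ((n:ℝ) + 1) ^ 0 := by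
    intro n x hx; simpa using tT_sq_le n hx
  set s := min s1 s2 with hs
  have hs0 : 0 < s := lt_min hs1 hs2
  have j1 := h1 s hs0 (min_le_left _ _)
  have j2 := h2 s hs0 (min_le_right _ _)
  set μ := ((volume.restrict (Set.Icc (-1:ℝ) 1)).prod (volume.restrict (Set.Icc (-1:ℝ) 1))) with hμ
  set I1 := ∫ p : ℝ × ℝ, (wG lam p.1 * wG lam p.2) * |p.1 - p.2| ^ (-s) ∂μ with hI1
  set I2 := ∫ p : ℝ × ℝ, (wG 0 p.1 * wG 0 p.2) * |p.1 - p.2| ^ (-s) ∂μ with hI2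
  obtain ⟨M, hM⟩ := exists_nat_ge (max 1 (((2 * K + 2 : ℕ) : ℝ) / s))
  have hM1 : (1:ℝ) ≤ M := (le_max_left _ _).trans hM
  have hMs : ((2 * K + 2 : ℕ) : ℝ) ≤ M * s := by
    have := (le_max_right _ _).trans hM
    rwa [div_le_iff₀ hs0] at this
  refine ⟨M * C, 1 / s * 2 ^ (2 * K + 2) * (A ^ 2 * |I1| + 2 ^ 2 * |I2|), fun n hn => ?_⟩
  have hn2 : (2:ℝ) ≤ n := by exact_mod_cast hn
  have hn0 : (0:ℝ) < n := by linarith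
  have hlog : log 2 ≤ log n := Real.log_le_log (by norm_num) hn2
  have hl2 : 0 < log 2 := Real.log_pos (by norm_num)
  set L := M * log n with hL
  have hL2 : log 2 ≤ L := by rw [hL]; nlinarith
  obtain ⟨f1, f2⟩ := ker_pow_int lam hlam (GegHat lam) (GegHat_cont lam) A hA K hK s j1 n
  obtain ⟨g1, g2⟩ := ker_pow_int 0 (by norm_num) tT tT_cont 2 (by norm_num) 0 hT s j2 n
  have fl := ker_log_int lam hlam (GegHat lam) (GegHat_cont lam) A hA K hK n
  have gl := ker_log_int 0 (by norm_num) tT tT_cont 2 (by norm_num) 0 hT n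
  obtain ⟨d1, d2⟩ := hD n (by omega)
  change Integrable (fun p => ker2 (wP lam) (n + 1) p ^ 2 * |p.1 - p.2| ^ (-s)) μ at f1
  change Integrable (fun p => ker2 wQ (n + 1) p ^ 2 * |p.1 - p.2| ^ (-s)) μ at g1
  change ∫ p, ker2 (wP lam) (n + 1) p ^ 2 * |p.1 - p.2| ^ (-s) ∂μ ≤ _ at f2
  change ∫ p, ker2 wQ (n + 1) p ^ 2 * |p.1 - p.2| ^ (-s) ∂μ ≤ _ at g2
  change Integrable (fun p => ker2 (wP lam) (n + 1) p ^ 2 * log (1 / |p.1 - p.2|)) μ at fl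
  change Integrable (fun p => ker2 wQ (n + 1) p ^ 2 * log (1 / |p.1 - p.2|)) μ at gl
  set c := 1 / s * exp (-(L * s)) with hc
  have hc0 : 0 ≤ c := by positivity
  have key : |L2 lam n - L20 n| ≤ L * (C * (n:ℝ) ^ (7/8 : ℝ)) +
      c * (A ^ 2 * ((n:ℝ) + 1) ^ (2 * K + 2) * I1 + 2 ^ 2 * ((n:ℝ) + 1) ^ (2 * 0 + 2) * I2) := by
    rw [L2_eq lam hlam h0, L20, ← integral_sub fl gl]
    have hfg := (f1.add g1).const_mul c
    simp only [Pi.add_apply] at hfg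
    have hdL := d1.abs.const_mul L
    calc |∫ p, (ker2 (wP lam) (n + 1) p ^ 2 * log (1 / |p.1 - p.2|) - ker2 wQ (n + 1) p ^ 2 * log (1 / |p.1 - p.2|)) ∂μ|
        ≤ ∫ p, |ker2 (wP lam) (n + 1) p ^ 2 * log (1 / |p.1 - p.2|) - ker2 wQ (n + 1) p ^ 2 * log (1 / |p.1 - p.2|)| ∂μ :=
          abs_integral_le_integral_abs
      _ ≤ ∫ p, (L * |ker2 (wP lam) (n + 1) p ^ 2 - ker2 wQ (n + 1) p ^ 2| +
          c * (ker2 (wP lam) (n + 1) p ^ 2 * |p.1 - p.2| ^ (-s) + ker2 wQ (n + 1) p ^ 2 * |p.1 - p.2| ^ (-s))) ∂μ := by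
          refine integral_mono_ae (fl.sub gl).abs (hdL.add hfg) ?_
          rw [hμ, Measure.prod_restrict]
          filter_upwards [ae_restrict_mem (measurableSet_Icc.prod measurableSet_Icc)] with z hz
          have hu : |z.1 - z.2| ≤ 2 := by
            have := hz.1; have := hz.2
            simp only [Set.mem_Icc] at *
            rw [abs_le]; constructor <;> linarith
          have ht := log_trunc s L _ hs0 hL2 hu (abs_nonneg _)
          rw [← hc] at ht
          rw [← sub_mul, abs_mul]
          have u0 : 0 ≤ |z.1 - z.2| ^ (-s) := by positivity
          have hF := sq_nonneg (ker2 (wP lam) (n + 1) z)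
          have hG := sq_nonneg (ker2 wQ (n + 1) z)
          have hab : |ker2 (wP lam) (n + 1) z ^ 2 - ker2 wQ (n + 1) z ^ 2| ≤ ker2 (wP lam) (n + 1) z ^ 2 + ker2 wQ (n + 1) z ^ 2 := by
            rw [abs_le]; constructor <;> linarith
          have q1 := mul_le_mul_of_nonneg_left ht (abs_nonneg (ker2 (wP lam) (n + 1) z ^ 2 - ker2 wQ (n + 1) z ^ 2))
          have q2 := mul_le_mul_of_nonneg_right hab (mul_nonneg hc0 u0)
          linarith
      _ = L * ∫ p, |ker2 (wP lam) (n + 1) p ^ 2 - ker2 wQ (n + 1) p ^ 2| ∂μ +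
          c * (∫ p, ker2 (wP lam) (n + 1) p ^ 2 * |p.1 - p.2| ^ (-s) ∂μ + ∫ p, ker2 wQ (n + 1) p ^ 2 * |p.1 - p.2| ^ (-s) ∂μ) := by
          rw [integral_add hdL hfg, integral_const_mul, integral_const_mul, integral_add f1 g1]
      _ ≤ _ := by
          have : 0 ≤ L := by linarith
          gcongr
  refine key.trans ?_
  have hexp : c * ((n:ℝ) + 1) ^ (2 * K + 2) ≤ 1 / s * 2 ^ (2 * K + 2) := by
    have e1 : exp (-(L * s)) ≤ ((n:ℝ) ^ (2 * K + 2))⁻¹ := by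
      rw [Real.exp_neg]
      apply inv_anti₀ (by positivity)
      rw [← Real.rpow_natCast, Real.rpow_def_of_pos hn0]
      apply Real.exp_le_exp.mpr
      rw [hL]
      have := mul_le_mul_of_nonneg_left hMs (hl2.le.trans hlog)
      linarith
    have e2 : ((n:ℝ) + 1) ^ (2 * K + 2) ≤ 2 ^ (2 * K + 2) * (n:ℝ) ^ (2 * K + 2) := by
      rw [← mul_pow]
      gcongr
      linarith
    rw [hc, mul_assoc]
    gcongr
    calc exp (-(L * s)) * ((n:ℝ) + 1) ^ (2 * K + 2) ≤ ((n:ℝ) ^ (2 * K + 2))⁻¹ * (2 ^ (2 * K + 2) * (n:ℝ) ^ (2 * K + 2)) := by gcongr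
      _ = _ := by field_simp
  have hp : ((n:ℝ) + 1) ^ (2 * 0 + 2) ≤ ((n:ℝ) + 1) ^ (2 * K + 2) :=
    pow_le_pow_right₀ (by linarith) (by omega)
  have hlast : c * (A ^ 2 * ((n:ℝ) + 1) ^ (2 * K + 2) * I1 + 2 ^ 2 * ((n:ℝ) + 1) ^ (2 * 0 + 2) * I2) ≤
      1 / s * 2 ^ (2 * K + 2) * (A ^ 2 * |I1| + 2 ^ 2 * |I2|) := by
    calc _ ≤ c * (A ^ 2 * ((n:ℝ) + 1) ^ (2 * K + 2) * |I1| + 2 ^ 2 * ((n:ℝ) + 1) ^ (2 * K + 2) * |I2|) := by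
          have a1 : A ^ 2 * ((n:ℝ) + 1) ^ (2 * K + 2) * I1 ≤ A ^ 2 * ((n:ℝ) + 1) ^ (2 * K + 2) * |I1| := by
            gcongr; exact le_abs_self _
          have a2 : 2 ^ 2 * ((n:ℝ) + 1) ^ (2 * 0 + 2) * I2 ≤ 2 ^ 2 * ((n:ℝ) + 1) ^ (2 * K + 2) * |I2| := by
            calc _ ≤ 2 ^ 2 * ((n:ℝ) + 1) ^ (2 * 0 + 2) * |I2| := by gcongr; exact le_abs_self _
              _ ≤ _ := by gcongr
          gcongr
      _ = (c * ((n:ℝ) + 1) ^ (2 * K + 2)) * (A ^ 2 * |I1| + 2 ^ 2 * |I2|) := by ring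
      _ ≤ _ := by gcongr
  have : L * (C * (n:ℝ) ^ (7/8 : ℝ)) = M * C * log n * (n:ℝ) ^ (7/8 : ℝ) := by rw [hL]; ring
  linarith

lemma cos_orth (a b : ℕ) : ∫ t in (0:ℝ)..π, cos (a * t) * cos (b * t) = if a = b then (if a = 0 then π else π / 2) else 0 := by
  have h := Polynomial.Chebyshev.integral_measureT_eq_integral_cos
    (f := fun x => (Polynomial.Chebyshev.T ℝ a).eval x * (Polynomial.Chebyshev.T ℝ b).eval x)
  simp only [Polynomial.Chebyshev.T_real_cos, Int.cast_natCast] at h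
  rw [← h]
  split_ifs with h1 h2
  · subst h1; subst h2
    simpa using Polynomial.Chebyshev.integral_eval_T_real_mul_self_measureT_zero
  · subst h1
    exact Polynomial.Chebyshev.integral_T_real_mul_self_measureT_of_ne_zero h2
  · exact Polynomial.Chebyshev.integral_eval_T_real_mul_eval_T_real_measureT_of_ne h1

noncomputable def qS (m : ℕ) (t : ℝ) : ℝ := ∑ k ∈ range m, 2 * cos ((2 * k + 1 : ℕ) * t)

lemma qS_sin (m : ℕ) (t : ℝ) : qS m t * sin t = sin (2 * m * t) := by
  induction m with
  | zero => simp [qS]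
  | succ m ih =>
    rw [qS, sum_range_succ, ← qS, add_mul, ih]
    have h1 : sin (2 * (m + 1 : ℕ) * t) = sin ((2 * m + 1 : ℕ) * t + t) := by congr 1; push_cast; ring
    have h2 : sin (2 * m * t) = sin ((2 * m + 1 : ℕ) * t - t) := by congr 1; push_cast; ring
    rw [h1, h2, sin_add, sin_sub]; ring

lemma qS_cont (m : ℕ) : Continuous (qS m) := by unfold qS; fun_prop

lemma qS_int (m : ℕ) (hm : 1 ≤ m) : ∫ t in (0:ℝ)..π, qS m t * cos t = π := by
  have e : ∀ t, qS m t * cos t = ∑ k ∈ range m, 2 * (cos ((2 * k + 1 : ℕ) * t) * cos ((1:ℕ) * t)) := by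
    intro t
    rw [qS, sum_mul]
    refine sum_congr rfl fun k _ => ?_
    push_cast
    rw [one_mul]; ring
  simp_rw [e]
  rw [intervalIntegral.integral_finsetSum (fun k _ => (by fun_prop : Continuous _).intervalIntegrable _ _)]
  simp_rw [intervalIntegral.integral_const_mul, cos_orth]
  rw [sum_eq_single 0]
  · simp; ring
  · intro k _ hk
    rw [if_neg (by omega)]; simp
  · intro h; simp at h; omega

lemma logsin_int (m : ℕ) (hm : 1 ≤ m) : ∫ t in (0:ℝ)..π, cos (2 * m * t) * log (sin t) = - (π / (2 * m)) := by
  have hm0 : (0:ℝ) < m := by exact_mod_cast hm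
  have hls : IntervalIntegrable (fun t => log (sin t)) volume 0 π := intervalIntegrable_log_sin
  have i1 : IntervalIntegrable (fun t => cos (2 * m * t) * log (sin t)) volume 0 π :=
    hls.continuousOn_mul (by fun_prop : Continuous fun t : ℝ => cos (2 * m * t)).continuousOn
  have i2 : IntervalIntegrable (fun t => 1 / (2 * m) * (qS m t * cos t)) volume 0 π := by
    have := qS_cont m
    exact (by fun_prop : Continuous fun t => 1 / (2 * (m:ℝ)) * (qS m t * cos t)).intervalIntegrable _ _
  have hF : ∫ t in (0:ℝ)..π, (cos (2 * m * t) * log (sin t) + 1 / (2 * m) * (qS m t * cos t)) =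
      (fun t => 1 / (2 * m) * (qS m t * (sin t * log (sin t)))) π - (fun t => 1 / (2 * m) * (qS m t * (sin t * log (sin t)))) 0 := by
    refine intervalIntegral.integral_eq_sub_of_hasDerivAt_of_le (f := fun t => 1 / (2 * (m:ℝ)) * (qS m t * (sin t * log (sin t)))) pi_pos.le ?_ ?_ (i1.add i2)
    · have h1 := qS_cont m
      have h2 := Real.continuous_mul_log.comp continuous_sin
      exact (continuous_const.mul (h1.mul h2)).continuousOn
    · intro t ht
      have hs : 0 < sin t := sin_pos_of_mem_Ioo ht
      have e : (fun t => 1 / (2 * m) * (qS m t * (sin t * log (sin t)))) = fun t => 1 / (2 * (m:ℝ)) * (sin (2 * m * t) * log (sin t)) := by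
        funext t; rw [← mul_assoc (qS m t), qS_sin]
      rw [e]
      have d1 : HasDerivAt (fun t => sin (2 * m * t)) (cos (2 * m * t) * (2 * m)) t := by
        have := ((hasDerivAt_id t).const_mul (2 * (m:ℝ))).sin
        simpa using this
      have d2 := (d1.mul ((hasDerivAt_sin t).log hs.ne')).const_mul (1 / (2 * (m:ℝ)))
      refine d2.congr_deriv ?_
      rw [← qS_sin]
      field_simp
  rw [intervalIntegral.integral_add i1 i2, intervalIntegral.integral_const_mul, qS_int m hm] at hF
  simp at hF
  have : π / (2 * m) = (m:ℝ)⁻¹ * 2⁻¹ * π := by field_simp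
  linarith

lemma logsin_odd (m : ℕ) : ∫ t in (0:ℝ)..π, sin (2 * m * t) * log (sin t) = 0 := by
  have h := intervalIntegral.integral_comp_sub_left (fun t => sin (2 * m * t) * log (sin t)) (a := 0) (b := π) π
  simp only [sub_self, sub_zero, sin_pi_sub] at h
  have e : ∀ x : ℝ, sin (2 * m * (π - x)) = - sin (2 * m * x) := by
    intro x
    have : 2 * (m:ℝ) * (π - x) = -(2 * m * x) + m * (2 * π) := by ring
    rw [this, sin_add_nat_mul_two_pi, sin_neg]
  simp_rw [e, neg_mul] at h
  rw [intervalIntegral.integral_neg] at h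
  linarith

noncomputable def kap (m : ℕ) : ℝ := if m = 0 then log 2 else 1 / m

lemma logsin_all (m : ℕ) : ∫ t in (0:ℝ)..π, cos (2 * m * t) * log (sin t) = if m = 0 then - log 2 * π else - (π / (2 * m)) := by
  split_ifs with h
  · subst h; simp only [Nat.cast_zero, mul_zero, zero_mul, cos_zero, one_mul]; exact integral_log_sin_zero_pi
  · exact logsin_int m (by omega)

lemma eig_int (f : ℝ → ℝ) (hf : Continuous f) (c a b : ℝ) : IntervalIntegrable (fun φ => f φ * log (sin ((φ - c) / 2))) volume a b := by
  have h : IntervalIntegrable (fun t => log (sin t)) volume ((a - c) / 2) ((b - c) / 2) := intervalIntegrable_log_sin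
  have h2 := (h.comp_mul_left (c := 1 / 2)).comp_sub_right c
  refine IntervalIntegrable.continuousOn_mul ?_ hf.continuousOn
  convert! h2 using 2 <;> ring_nf

lemma eig_per (m : ℕ) (θ : ℝ) : ∫ φ in (-π)..π, cos (m * φ) * log (sin ((φ - θ) / 2)) =
    2 * cos (m * θ) * if m = 0 then - log 2 * π else - (π / (2 * m)) := by
  have hper : Function.Periodic (fun φ : ℝ => cos (m * φ) * log (sin ((φ - θ) / 2))) (2 * π) := by
    intro φ
    simp only
    have e1 : (m:ℝ) * (φ + 2 * π) = m * φ + m * (2 * π) := by ring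
    have e2 : (φ + 2 * π - θ) / 2 = (φ - θ) / 2 + π := by ring
    rw [e1, e2, cos_add_nat_mul_two_pi, sin_add_pi, log_neg_eq_log]
  have h1 := hper.intervalIntegral_add_eq (-π) θ
  have e : -π + 2 * π = π := by ring
  rw [e] at h1
  rw [h1]
  have h2 := intervalIntegral.mul_integral_comp_mul_add (f := fun φ : ℝ => cos (m * φ) * log (sin ((φ - θ) / 2))) (a := 0) (b := π) 2 θ
  have e3 : 2 * 0 + θ = θ := by ring
  have e4 : 2 * π + θ = θ + 2 * π := by ring
  rw [e3, e4] at h2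
  rw [← h2]
  have hls : IntervalIntegrable (fun t => log (sin t)) volume 0 π := intervalIntegrable_log_sin
  have i1 : IntervalIntegrable (fun t => cos (2 * m * t) * log (sin t)) volume 0 π :=
    hls.continuousOn_mul (by fun_prop : Continuous fun t : ℝ => cos (2 * m * t)).continuousOn
  have i2 : IntervalIntegrable (fun t => sin (2 * m * t) * log (sin t)) volume 0 π :=
    hls.continuousOn_mul (by fun_prop : Continuous fun t : ℝ => sin (2 * m * t)).continuousOn
  have e5 : ∀ t, cos (m * (2 * t + θ)) * log (sin ((2 * t + θ - θ) / 2)) =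
      cos (m * θ) * (cos (2 * m * t) * log (sin t)) - sin (m * θ) * (sin (2 * m * t) * log (sin t)) := by
    intro t
    have a1 : (m:ℝ) * (2 * t + θ) = 2 * m * t + m * θ := by ring
    have a2 : (2 * t + θ - θ) / 2 = t := by ring
    rw [a1, a2, cos_add]; ring
  simp_rw [e5]
  rw [intervalIntegral.integral_sub (i1.const_mul _) (i2.const_mul _), intervalIntegral.integral_const_mul,
    intervalIntegral.integral_const_mul, logsin_odd, logsin_all]
  ring

lemma eig (m : ℕ) (θ : ℝ) (hθ : θ ∈ Set.Icc 0 π) :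
    IntervalIntegrable (fun φ => cos (m * φ) * log (1 / |cos θ - cos φ|)) volume 0 π ∧
    ∫ φ in (0:ℝ)..π, cos (m * φ) * log (1 / |cos θ - cos φ|) = π * kap m * cos (m * θ) := by
  have hc : Continuous fun φ : ℝ => cos (m * φ) := by fun_prop
  have i1 := eig_int _ hc θ 0 π
  have i1' := eig_int _ hc θ (-π) 0
  have i2 := eig_int _ hc (-θ) 0 π
  have i3 : IntervalIntegrable (fun φ : ℝ => log 2 * cos (m * φ)) volume 0 π := (hc.const_mul _).intervalIntegrable _ _
  have hae : ∀ᵐ φ : ℝ, φ ∈ Set.uIoc 0 π → -(log 2 * cos (m * φ)) - cos (m * φ) * log (sin ((φ - θ) / 2))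
       - cos (m * φ) * log (sin ((φ - -θ) / 2)) = cos (m * φ) * log (1 / |cos θ - cos φ|) := by
    filter_upwards [Measure.ae_ne volume θ] with φ hφ hm
    rw [Set.uIoc_of_le pi_pos.le] at hm
    have hne : cos θ - cos φ ≠ 0 := by
      intro h
      exact hφ (injOn_cos ⟨hm.1.le, hm.2⟩ hθ (by linarith))
    have e : cos θ - cos φ = 2 * sin ((φ - θ) / 2) * sin ((φ - -θ) / 2) := by
      rw [cos_sub_cos]
      have : (θ - φ) / 2 = - ((φ - θ) / 2) := by ring
      have e2 : (θ + φ) / 2 = (φ - -θ) / 2 := by ring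
      rw [this, sin_neg, e2]; ring
    rw [e] at hne
    have n1 : sin ((φ - θ) / 2) ≠ 0 := fun h => hne (by rw [h]; ring)
    have n2 : sin ((φ - -θ) / 2) ≠ 0 := fun h => hne (by rw [h]; ring)
    rw [one_div, log_inv, log_abs, e, log_mul (by positivity) n2, log_mul (by norm_num) n1]
    ring
  have hsum := (i3.neg.sub i1).sub i2
  constructor
  · refine hsum.congr_ae ?_
    rw [Filter.EventuallyEq, ae_restrict_iff' measurableSet_uIoc]
    exact hae
  · rw [← intervalIntegral.integral_congr_ae hae]
    have s1 := intervalIntegral.integral_sub (i3.neg.sub i1) i2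
    have s2 := intervalIntegral.integral_sub i3.neg i1
    simp only [Pi.sub_apply, Pi.neg_apply] at s1 s2
    rw [s1, s2, intervalIntegral.integral_neg, intervalIntegral.integral_const_mul]
    have hneg : ∫ φ in (0:ℝ)..π, cos (m * φ) * log (sin ((φ - -θ) / 2)) = ∫ φ in (-π)..0, cos (m * φ) * log (sin ((φ - θ) / 2)) := by
      have := intervalIntegral.integral_comp_neg (fun φ : ℝ => cos (m * φ) * log (sin ((φ - θ) / 2))) (a := 0) (b := π)
      rw [neg_zero] at this
      rw [← this]
      refine intervalIntegral.integral_congr fun φ _ => ?_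
      have e1 : (m:ℝ) * -φ = -(m * φ) := by ring
      have e2 : (-φ - θ) / 2 = - ((φ - -θ) / 2) := by ring
      rw [e1, cos_neg, e2, sin_neg, log_neg_eq_log]
    have hadj := intervalIntegral.integral_add_adjacent_intervals i1' i1
    rw [eig_per] at hadj
    have hcos : ∫ φ in (0:ℝ)..π, cos (m * φ) = if m = 0 then π else 0 := by
      have := cos_orth m 0
      simp only [Nat.cast_zero, zero_mul, cos_zero, mul_one] at this
      rw [this]
      split_ifs <;> simp_all
    rw [hneg, hcos]
    unfold kap
    split_ifs at hadj ⊢ with h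
    · subst h; simp at hadj ⊢; linarith
    · have hm0 : (m:ℝ) ≠ 0 := by exact_mod_cast h
      have : 2 * cos (m * θ) * -(π / (2 * m)) = - (π * (1 / m) * cos (m * θ)) := by field_simp
      linarith

lemma wlog_int : Integrable (fun p : ℝ × ℝ => (wG 0 p.1 * wG 0 p.2) * log (1 / |p.1 - p.2|))
      ((volume.restrict (Set.Icc (-1:ℝ) 1)).prod (volume.restrict (Set.Icc (-1:ℝ) 1))) := by
  have h := ker_log_int 0 (by norm_num) (fun _ _ => 1) (fun _ => continuous_const) 1 (by norm_num) 0 (fun n x _ => by simp) 0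
  refine h.congr ?_
  rw [Measure.prod_restrict]
  filter_upwards [ae_restrict_mem (measurableSet_Icc.prod measurableSet_Icc)] with z hz
  simp only [ker2, zero_add, sum_range_one, one_mul, mul_pow]
  rw [Real.sq_sqrt (wG_nonneg 0 (by norm_num) hz.1), Real.sq_sqrt (wG_nonneg 0 (by norm_num) hz.2)]

noncomputable def VV (i j : ℕ) (p : ℝ × ℝ) : ℝ :=
  ((tT i p.1 * tT j p.1) * (tT i p.2 * tT j p.2)) * ((wG 0 p.1 * wG 0 p.2) * log (1 / |p.1 - p.2|))

lemma tT_abs (j : ℕ) {x : ℝ} (hx : x ∈ Set.Icc (-1:ℝ) 1) : |tT j x| ≤ 2 := by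
  have := tT_sq_le j hx
  exact abs_le_of_sq_le_sq (by linarith) (by norm_num)

lemma VV_int (i j : ℕ) : Integrable (VV i j)
      ((volume.restrict (Set.Icc (-1:ℝ) 1)).prod (volume.restrict (Set.Icc (-1:ℝ) 1))) := by
  have h1 := tT_cont i
  have h2 := tT_cont j
  refine wlog_int.bdd_mul (c := 16) (by fun_prop : Continuous fun p : ℝ × ℝ => (tT i p.1 * tT j p.1) * (tT i p.2 * tT j p.2)).aestronglyMeasurable ?_
  rw [Measure.prod_restrict]
  filter_upwards [ae_restrict_mem (measurableSet_Icc.prod measurableSet_Icc)] with z hz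
  rw [Real.norm_eq_abs, abs_mul, abs_mul, abs_mul]
  have a1 := tT_abs i hz.1
  have a2 := tT_abs j hz.1
  have a3 := tT_abs i hz.2
  have a4 := tT_abs j hz.2
  calc _ ≤ (2 * 2) * (2 * 2 : ℝ) := by gcongr
    _ = 16 := by norm_num

noncomputable def V (i j : ℕ) : ℝ := ∫ p, VV i j p ∂((volume.restrict (Set.Icc (-1:ℝ) 1)).prod (volume.restrict (Set.Icc (-1:ℝ) 1)))

lemma L20_eq (n : ℕ) : L20 n = ∑ i ∈ range (n + 1), ∑ j ∈ range (n + 1), V i j := by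
  unfold V
  simp_rw [← integral_finsetSum _ (fun j _ => VV_int _ j)]
  rw [← integral_finsetSum _ (fun i _ => integrable_finsetSum _ (fun j _ => VV_int i j)), L20, Measure.prod_restrict]
  refine setIntegral_congr_fun (measurableSet_Icc.prod measurableSet_Icc) fun p hp => ?_
  have hT : ∀ n : ℕ, ∀ x ∈ Set.Icc (-1:ℝ) 1, tT n x ^ 2 ≤ 2 * ((n:ℝ) + 1) ^ 0 := by
    intro n x hx; simpa using tT_sq_le n hx
  have := (ker_bound tT (wG 0) (fun x hx => wG_nonneg 0 (by norm_num) hx) 2 (by norm_num) 0 hT n p hp).1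
  change ker2 wQ (n + 1) p ^ 2 = _ at this
  simp only [this]
  rw [sq, sum_mul_sum, sum_mul, sum_mul]
  refine sum_congr rfl fun i _ => ?_
  rw [sum_mul, sum_mul]
  refine sum_congr rfl fun j _ => ?_
  unfold VV; ring

lemma V_symm (i j : ℕ) : V i j = V j i := by
  unfold V; congr 1; funext p; unfold VV; ring

noncomputable def hh (a : ℕ) : ℝ := if a = 0 then 1 else 1 / 2

lemma V_eval (i j a b : ℕ) (α β : ℝ) (hab : a ≠ b)
    (e : ∀ θ, tT i (cos θ) * tT j (cos θ) = α * cos (a * θ) + β * cos (b * θ)) :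
    V i j = α ^ 2 * kap a * hh a + β ^ 2 * kap b * hh b := by
  have hpi := Real.pi_pos.ne'
  unfold V
  rw [integral_prod _ (VV_int i j)]
  have s1 : ∀ x, ∫ y in Set.Icc (-1:ℝ) 1, VV i j (x, y) =
      (π⁻¹ * ∫ φ in (0:ℝ)..π, (tT i x * tT j x) * (tT i (cos φ) * tT j (cos φ)) * log (1 / |x - cos φ|)) * wG 0 x := by
    intro x
    rw [← int_wG_zero (fun y => (tT i x * tT j x) * (tT i y * tT j y) * log (1 / |x - y|)), ← integral_mul_const]
    refine setIntegral_congr_fun measurableSet_Icc fun y hy => ?_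
    simp only [VV]; ring
  simp_rw [s1]
  rw [int_wG_zero (fun x => π⁻¹ * ∫ φ in (0:ℝ)..π, (tT i x * tT j x) * (tT i (cos φ) * tT j (cos φ)) * log (1 / |x - cos φ|))]
  have s2 : ∫ θ in (0:ℝ)..π, π⁻¹ * ∫ φ in (0:ℝ)..π, (tT i (cos θ) * tT j (cos θ)) * (tT i (cos φ) * tT j (cos φ)) * log (1 / |cos θ - cos φ|)
      = ∫ θ in (0:ℝ)..π, (α ^ 2 * kap a * (cos (a * θ) * cos (a * θ)) + β ^ 2 * kap b * (cos (b * θ) * cos (b * θ)) +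
        α * β * (kap a + kap b) * (cos (a * θ) * cos (b * θ))) := by
    refine intervalIntegral.integral_congr fun θ hθ => ?_
    rw [Set.uIcc_of_le pi_pos.le] at hθ
    obtain ⟨ia, ea⟩ := eig a θ hθ
    obtain ⟨ib, eb⟩ := eig b θ hθ
    have e1 : ∀ φ, (tT i (cos θ) * tT j (cos θ)) * (tT i (cos φ) * tT j (cos φ)) * log (1 / |cos θ - cos φ|) =
        ((α * cos (a * θ) + β * cos (b * θ)) * α) * (cos (a * φ) * log (1 / |cos θ - cos φ|)) +
        ((α * cos (a * θ) + β * cos (b * θ)) * β) * (cos (b * φ) * log (1 / |cos θ - cos φ|)) := by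
      intro φ; rw [e, e]; ring
    simp_rw [e1]
    rw [intervalIntegral.integral_add (ia.const_mul _) (ib.const_mul _), intervalIntegral.integral_const_mul,
      intervalIntegral.integral_const_mul, ea, eb]
    field_simp
    ring
  rw [s2, intervalIntegral.integral_add, intervalIntegral.integral_add, intervalIntegral.integral_const_mul,
    intervalIntegral.integral_const_mul, intervalIntegral.integral_const_mul, cos_orth, cos_orth, cos_orth, if_pos rfl, if_pos rfl,
    if_neg hab]
  · have hh1 : ∀ a, (if a = 0 then π else π / 2) = π * hh a := by
      intro a; unfold hh; split_ifs <;> ring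
    rw [hh1, hh1]
    field_simp
    ring
  all_goals exact (by fun_prop : Continuous _).intervalIntegrable _ _

lemma tT_cos (j : ℕ) (hj : j ≠ 0) (θ : ℝ) : tT j (cos θ) = √2 * cos (j * θ) := by
  unfold tT; rw [if_neg hj, Polynomial.Chebyshev.T_real_cos]; simp

lemma V00 : V 0 0 = log 2 := by
  rw [V_eval 0 0 0 1 1 0 (by norm_num) (by intro θ; simp [tT])]
  simp [kap, hh]

lemma V0j (j : ℕ) (hj : j ≠ 0) : V 0 j = 1 / j := by
  rw [V_eval 0 j j 0 (√2) 0 hj (by intro θ; rw [tT_cos j hj]; simp [tT])]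
  rw [Real.sq_sqrt (by norm_num), kap, hh, if_neg hj, if_neg hj]
  ring

lemma cos_prod (i j : ℕ) (hi : i ≠ 0) (hj : j ≠ 0) (hij : i ≤ j) (θ : ℝ) :
    tT i (cos θ) * tT j (cos θ) = 1 * cos ((j + i : ℕ) * θ) + 1 * cos ((j - i : ℕ) * θ) := by
  rw [tT_cos i hi, tT_cos j hj]
  push_cast [Nat.cast_sub hij]
  rw [add_mul, sub_mul, cos_add, cos_sub]
  have : √2 * √2 = (2:ℝ) := Real.mul_self_sqrt (by norm_num)
  linear_combination (cos (i * θ) * cos (j * θ)) * this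

lemma Vij (i j : ℕ) (hi : i ≠ 0) (hij : i < j) : V i j = 1 / 2 * (1 / ((j + i : ℕ) : ℝ) + 1 / ((j - i : ℕ) : ℝ)) := by
  rw [V_eval i j (j + i) (j - i) 1 1 (by omega) (cos_prod i j hi (by omega) hij.le)]
  rw [kap, hh, kap, hh, if_neg (by omega), if_neg (by omega), if_neg (by omega), if_neg (by omega)]
  ring

lemma Vjj (j : ℕ) (hj : j ≠ 0) : V j j = 1 / (4 * j) + log 2 := by
  rw [V_eval j j (j + j) (j - j) 1 1 (by omega) (cos_prod j j hj hj le_rfl)]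
  rw [kap, hh, kap, hh, if_neg (by omega), if_neg (by omega), if_pos (by omega), if_pos (by omega)]
  have : (j:ℝ) ≠ 0 := by exact_mod_cast hj
  push_cast
  field_simp
  ring

lemma harm_split (N : ℕ) : ∑ i ∈ range N, (1 / ((N + 1 + (i + 1) : ℕ) : ℝ) + 1 / ((N + 1 - (i + 1) : ℕ) : ℝ)) =
    (harmonic (2 * N + 1) : ℝ) - 1 / ((N:ℝ) + 1) := by
  rw [sum_add_distrib]
  have h1 : ∑ i ∈ range N, 1 / ((N + 1 - (i + 1) : ℕ) : ℝ) = (harmonic N : ℝ) := by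
    rw [harmonic]
    push_cast
    rw [← sum_range_reflect]
    refine sum_congr rfl fun i hi => ?_
    have : i < N := by simpa using hi
    have e : N - (N - 1 - i) = i + 1 := by omega
    rw [e]; push_cast; rw [one_div]
  have h2 : (harmonic (2 * N + 1) : ℝ) = (harmonic N : ℝ) + 1 / ((N:ℝ) + 1) + ∑ i ∈ range N, 1 / ((N + 1 + (i + 1) : ℕ) : ℝ) := by
    have e : 2 * N + 1 = (N + 1) + N := by ring
    rw [e, harmonic, sum_range_add, ← harmonic, harmonic_succ]
    push_cast
    congr 1
    · rw [one_div]
    · refine sum_congr rfl fun i _ => ?_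
      rw [one_div]; congr 1; ring
  rw [h1, h2]; ring

lemma L20_formula (n : ℕ) : L20 n = (n + 1) * log 2 + (n + 1 / 2) * (harmonic (2 * n) : ℝ) - n + (harmonic n : ℝ) := by
  induction n with
  | zero => rw [L20_eq]; simp [V00]
  | succ n ih =>
    have step : L20 (n + 1) = L20 n + 2 * ∑ i ∈ range (n + 1), V i (n + 1) + V (n + 1) (n + 1) := by
      rw [L20_eq, L20_eq, sum_range_succ _ (n + 1)]
      simp_rw [sum_range_succ _ (n + 1)]
      rw [sum_add_distrib]
      have : ∑ j ∈ range (n + 1), V (n + 1) j = ∑ i ∈ range (n + 1), V i (n + 1) := sum_congr rfl fun i _ => V_symm _ _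
      rw [this]; ring
    have hs : ∑ i ∈ range (n + 1), V i (n + 1) = 1 / ((n:ℝ) + 1) + 1 / 2 * ((harmonic (2 * n + 1) : ℝ) - 1 / ((n:ℝ) + 1)) := by
      rw [sum_range_succ', V0j _ (by omega), ← harm_split, mul_sum, add_comm]
      congr 1
      · push_cast; rfl
      · refine sum_congr rfl fun i hi => ?_
        have : i < n := by simpa using hi
        rw [Vij _ _ (by omega) (by omega)]
    rw [step, hs, Vjj _ (by omega), ih]
    have e1 : 2 * (n + 1) = (2 * n + 1) + 1 := by ring
    rw [e1, harmonic_succ (2 * n + 1), harmonic_succ (2 * n), harmonic_succ n]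
    push_cast
    have : (n:ℝ) + 1 ≠ 0 := by positivity
    have : 2 * (n:ℝ) + 1 ≠ 0 := by positivity
    have : 2 * (n:ℝ) + 1 + 1 ≠ 0 := by positivity
    field_simp
    ring

lemma log_div_tendsto : Filter.Tendsto (fun n : ℕ => log n / (n:ℝ)) Filter.atTop (nhds 0) := by
  have := (isLittleO_log_id_atTop.tendsto_div_nhds_zero).comp (tendsto_natCast_atTop_atTop (R := ℝ))
  exact this

lemma main_part : Filter.Tendsto (fun n : ℕ => L20 n / n - log n - (Real.eulerMascheroniConstant + 2 * Real.log 2 - 1))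
    Filter.atTop (nhds 0) := by
  have hb := Real.tendsto_harmonic_sub_log
  have h2 : Filter.Tendsto (fun n : ℕ => 2 * n) Filter.atTop Filter.atTop :=
    Filter.tendsto_id.const_mul_atTop' (by norm_num : 0 < 2)
  have ha := hb.comp h2
  have hi : Filter.Tendsto (fun n : ℕ => 1 / (n:ℝ)) Filter.atTop (nhds 0) := tendsto_one_div_atTop_nhds_zero_nat
  have hl := log_div_tendsto
  have h := ((ha.sub_const Real.eulerMascheroniConstant).add (hi.const_mul (log 2))).add
    (((((ha.add_const (log 2)).mul hi).add hl).const_mul (1 / 2)).add ((hb.mul hi).add hl))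
  simp only [sub_self, mul_zero, add_zero] at h
  refine h.congr' ?_
  filter_upwards [Filter.eventually_ge_atTop 1] with n hn
  have hn0 : (n:ℝ) ≠ 0 := by positivity
  simp only [Function.comp]
  rw [L20_formula]
  push_cast
  rw [Real.log_mul (by norm_num) hn0]
  field_simp
  ring

theorem gegenbauer_L2_asymptotics (lam : ℝ) (hlam : -(1 / 2) < lam) (hlam0 : lam ≠ 0) :
    Filter.Tendsto
      (fun n : ℕ =>
        (L2 lam n - (n : ℝ) * Real.log (n : ℝ)
            - (Real.eulerMascheroniConstant + 2 * Real.log 2 - 1) * (n : ℝ)) / (n : ℝ))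
      Filter.atTop (nhds 0) := by
  obtain ⟨C1, C2, hC⟩ := L2_diff lam hlam hlam0
  have hd : Filter.Tendsto (fun n : ℕ => (L2 lam n - L20 n) / n) Filter.atTop (nhds 0) := by
    have hl : Filter.Tendsto (fun n : ℕ => log n / (n:ℝ) ^ (1/8 : ℝ)) Filter.atTop (nhds 0) :=
      ((isLittleO_log_rpow_atTop (by norm_num : (0:ℝ) < 1/8)).tendsto_div_nhds_zero).comp tendsto_natCast_atTop_atTop
    have hi : Filter.Tendsto (fun n : ℕ => 1 / (n:ℝ)) Filter.atTop (nhds 0) := tendsto_one_div_atTop_nhds_zero_nat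
    have hz := (hl.const_mul C1).add (hi.const_mul C2)
    simp only [mul_zero, add_zero] at hz
    refine squeeze_zero_norm' ?_ hz
    filter_upwards [Filter.eventually_ge_atTop 2] with n hn
    have hn0 : (0:ℝ) < n := by positivity
    rw [norm_div, Real.norm_eq_abs, Real.norm_of_nonneg hn0.le, div_le_iff₀ hn0]
    refine (hC n hn).trans (le_of_eq ?_)
    have e : (n:ℝ) = (n:ℝ) ^ (7/8 : ℝ) * (n:ℝ) ^ (1/8 : ℝ) := by
      rw [← Real.rpow_add hn0]; norm_num
    have hp : (n:ℝ) ^ (1/8 : ℝ) ≠ 0 := by positivity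
    rw [add_mul, mul_assoc C2, one_div_mul_cancel hn0.ne', mul_one]
    congr 1
    have : C1 * (log n / (n:ℝ) ^ (1/8 : ℝ)) * n = C1 * (log n / (n:ℝ) ^ (1/8 : ℝ)) * ((n:ℝ) ^ (7/8 : ℝ) * (n:ℝ) ^ (1/8 : ℝ)) := by
      rw [← e]
    rw [this]
    field_simp
  have h := hd.add main_part
  rw [add_zero] at h
  refine h.congr' ?_
  filter_upwards [Filter.eventually_ge_atTop 1] with n hn
  have hn0 : (n:ℝ) ≠ 0 := by positivity
  field_simp
  ring
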